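/- arXiv:1412.2654 — 2 statements merged into one kernel-verified Lean document; each statement's English description precedes it below -/
import Mathlib

section
/- Let R be a d-dimensional Cohen-Macaulay commutative noetherian ring with a dualizing module D, and let C be a semidualizing R-module. If G is a C-Gorenstein injective R-module, then G has a filtration 0 = G_{d+1} ⊂ G_d ⊂ ⋯ ⊂ G_1 ⊂ G_0 = G such that each submodule G_k is C-Gorenstein injective, each quotient G_k/G_{k+1} is C-Gorenstein injective and decomposes as G_k/G_{k+1} ≅ ⊕_{ht(p)=k} G_{(p)}, where G_{(p)} ≅ Γ_p(G_p), and each module G_{(p)} is C-Gorenstein injective and satisfies property t(p). -/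
/-!
Common definitions: property t(p), injective hulls, (C-)Gorenstein injective modules,
(C-)Gorenstein injective / injective / flat dimensions, small support, torsion functor,
Tor and Ext modules, semidualizing and dualizing modules, depth, Cohen-Macaulay rings,
Serre's condition (S₁), Gorenstein local rings, minimal injective resolutions.
-/

universe u

open CategoryTheory Limits DirectSum

noncomputable section

/-- An `R`-module `S` has property `t(p)`: multiplication by every `r ∉ p` is bijective on `S`,
and every element of `S` is annihilated by a power of `p`. -/
def PropT (R : Type u) [CommRing R] (p : Ideal R) (S : Type u) [AddCommGroup S]
    [Module R S] : Prop :=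
  (∀ r : R, r ∉ p → Function.Bijective (fun s : S => r • s)) ∧
  (∀ x : S, ∃ m : ℕ, 0 < m ∧ ∀ a ∈ p ^ m, a • x = 0)

/-- `E` is an injective hull of `N` over `R`: `E` is injective and `N` embeds in `E` as an
essential submodule. -/
def IsInjectiveHull (R : Type u) [CommRing R] (N : Type u) [AddCommGroup N] [Module R N]
    (E : Type u) [AddCommGroup E] [Module R E] : Prop :=
  Module.Injective R E ∧ ∃ ι : N →ₗ[R] E, Function.Injective ι ∧
    ∀ K : Submodule R E, K ≠ ⊥ → K ⊓ LinearMap.range ι ≠ ⊥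

/-- A complete injective resolution: a doubly infinite exact sequence of injective modules
which stays exact after applying `Hom_R(-, I)` for every injective module `I`. -/
structure CompleteInjRes (R : Type u) [CommRing R] where
  E : ℤ → Type u
  [acg : ∀ i, AddCommGroup (E i)]
  [mod : ∀ i, Module R (E i)]
  d : ∀ i, E i →ₗ[R] E (i + 1)
  inj : ∀ i, Module.Injective R (E i)
  exct : ∀ i, LinearMap.range (d i) = LinearMap.ker (d (i + 1))
  homExact : ∀ (I : Type u) [AddCommGroup I] [Module R I], Module.Injective R I →
    ∀ (i : ℤ) (g : E (i + 1) →ₗ[R] I), g ∘ₗ d i = 0 →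
      ∃ h : E (i + 1 + 1) →ₗ[R] I, h ∘ₗ d (i + 1) = g

attribute [instance] CompleteInjRes.acg CompleteInjRes.mod

/-- `G` is a Gorenstein injective `R`-module: it is the image of some map in a complete
injective resolution. -/
def GorensteinInjective (R : Type u) [CommRing R] (G : Type u) [AddCommGroup G]
    [Module R G] : Prop :=
  ∃ X : CompleteInjRes R, Nonempty (G ≃ₗ[R] LinearMap.range (X.d 0))

/-- A complete `I_C I`-resolution: an exact sequence
`⋯ → Hom(C,I₁) → Hom(C,I₀) → I⁰ → I¹ → ⋯` (terms in nonnegative degrees are injective,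
terms in negative degrees are of the form `Hom_R(C, I)` with `I` injective) such that
`Hom_R(Hom_R(C,J), -)` leaves it exact for every injective `R`-module `J`. -/
structure CompleteICIRes (R : Type u) [CommRing R] (C : Type u) [AddCommGroup C]
    [Module R C] where
  X : ℤ → Type u
  [acg : ∀ i, AddCommGroup (X i)]
  [mod : ∀ i, Module R (X i)]
  d : ∀ i, X i →ₗ[R] X (i + 1)
  exct : ∀ i, LinearMap.range (d i) = LinearMap.ker (d (i + 1))
  injPos : ∀ i : ℤ, 0 ≤ i → Module.Injective R (X i)
  homCInjNeg : ∀ i : ℤ, i < 0 → ∃ (I : Type u) (_ : AddCommGroup I) (_ : Module R I),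
    Module.Injective R I ∧ Nonempty (X i ≃ₗ[R] (C →ₗ[R] I))
  homExact : ∀ (J : Type u) [AddCommGroup J] [Module R J], Module.Injective R J →
    ∀ (i : ℤ) (g : (C →ₗ[R] J) →ₗ[R] X (i + 1)), d (i + 1) ∘ₗ g = 0 →
      ∃ h : (C →ₗ[R] J) →ₗ[R] X i, d i ∘ₗ h = g

attribute [instance] CompleteICIRes.acg CompleteICIRes.mod

/-- `G` is a `C`-Gorenstein injective `R`-module: it is the image of the map
`Hom_R(C, I₀) → I⁰` in some complete `I_C I`-resolution. -/
def CGorensteinInjective (R : Type u) [CommRing R] (C : Type u) [AddCommGroup C] [Module R C]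
    (G : Type u) [AddCommGroup G] [Module R G] : Prop :=
  ∃ X : CompleteICIRes R C, Nonempty (G ≃ₗ[R] LinearMap.range (X.d (-1)))

/-- `M` has a `C`-Gorenstein injective coresolution `0 → M → G⁰ → ⋯ → Gⁿ → 0`,
i.e. `C`-Gorenstein injective dimension at most `n`. -/
def CGidLE (R : Type u) [CommRing R] (C : Type u) [AddCommGroup C] [Module R C] :
    ℕ → ModuleCat.{u} R → Prop
  | 0, M => CGorensteinInjective R C M
  | n + 1, M => ∃ (G : ModuleCat.{u} R), CGorensteinInjective R C G ∧
      ∃ ι : M →ₗ[R] G, Function.Injective ι ∧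
        CGidLE R C n (ModuleCat.of R (G ⧸ LinearMap.range ι))

/-- The `C`-Gorenstein injective dimension of `M` (equal to `⊤` if `M` admits no bounded
coresolution by `C`-Gorenstein injective modules). -/
def CGid (R : Type u) [CommRing R] (C : Type u) [AddCommGroup C] [Module R C]
    (M : Type u) [AddCommGroup M] [Module R M] : ℕ∞ :=
  sInf {n : ℕ∞ | ∃ m : ℕ, (m : ℕ∞) = n ∧ CGidLE R C m (ModuleCat.of R M)}

/-- There exists an exact sequence `0 → N → Gₙ → ⋯ → G₁ → M → 0` in which each `Gᵢ` is
`C`-Gorenstein injective (and `N` is arbitrary). -/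
def CGICoresApprox (R : Type u) [CommRing R] (C : Type u) [AddCommGroup C] [Module R C] :
    ℕ → ModuleCat.{u} R → Prop
  | 0, _ => True
  | n + 1, M => ∃ (G : ModuleCat.{u} R), CGorensteinInjective R C G ∧
      ∃ π : G →ₗ[R] M, Function.Surjective π ∧
        CGICoresApprox R C n (ModuleCat.of R (LinearMap.ker π))

/-- The `a`-torsion submodule `Γ_a(N)` of `N`. -/
def torsionSubmodule (R : Type u) [CommRing R] (a : Ideal R) (N : Type u) [AddCommGroup N]
    [Module R N] : Submodule R N :=
  ⨆ m : ℕ, Submodule.torsionBySet R N ((a ^ m : Ideal R) : Set R)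

/-- `Tor_i^R(M, N)`, as an object of `ModuleCat R`. -/
abbrev TorM (R : Type u) [CommRing R] (i : ℕ) (M N : Type u) [AddCommGroup M] [Module R M]
    [AddCommGroup N] [Module R N] : ModuleCat.{u} R :=
  ((Tor (ModuleCat.{u} R) i).obj (ModuleCat.of R M)).obj (ModuleCat.of R N)

/-- `Ext_R^i(M, N)`, as an object of `ModuleCat R`. -/
abbrev ExtM (R : Type u) [CommRing R] (i : ℕ) (M N : Type u) [AddCommGroup M] [Module R M]
    [AddCommGroup N] [Module R N] : ModuleCat.{u} R :=
  ((Ext R (ModuleCat.{u} R) i).obj (Opposite.op (ModuleCat.of R M))).obj (ModuleCat.of R N)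

/-- The small support of `M`: primes `p` such that `Tor_i^R(κ(p), M) ≠ 0` for some `i`,
where `κ(p)` is the residue field of `R_p`. -/
def smallSupport (R : Type u) [CommRing R] (M : Type u) [AddCommGroup M] [Module R M] :
    Set (PrimeSpectrum R) :=
  {p | ∃ i : ℕ,
    Nontrivial (TorM R i (IsLocalRing.ResidueField (Localization.AtPrime p.asIdeal)) M)}

/-- `C` is a semidualizing `R`-module: finitely generated, the homothety map
`R → Hom_R(C,C)` is bijective, and `Ext_R^i(C,C) = 0` for `i ≥ 1`. -/
def IsSemidualizing (R : Type u) [CommRing R] (C : Type u) [AddCommGroup C] [Module R C] : Prop :=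
  Module.Finite R C ∧
  Function.Bijective (fun r : R => (r • LinearMap.id : C →ₗ[R] C)) ∧
  ∀ i : ℕ, 1 ≤ i → Subsingleton (ExtM R i C C)

/-- `M` has injective dimension at most `n`. -/
def InjDimLE (R : Type u) [CommRing R] : ℕ → ModuleCat.{u} R → Prop
  | 0, M => Module.Injective R M
  | n + 1, M => ∃ (I : ModuleCat.{u} R), Module.Injective R I ∧
      ∃ ι : M →ₗ[R] I, Function.Injective ι ∧
        InjDimLE R n (ModuleCat.of R (I ⧸ LinearMap.range ι))

/-- `M` has flat dimension at most `n`. -/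
def FlatDimLE (R : Type u) [CommRing R] : ℕ → ModuleCat.{u} R → Prop
  | 0, M => Module.Flat R M
  | n + 1, M => ∃ (F : ModuleCat.{u} R), Module.Flat R F ∧
      ∃ π : F →ₗ[R] M, Function.Surjective π ∧
        FlatDimLE R n (ModuleCat.of R (LinearMap.ker π))

/-- `D` is a dualizing `R`-module: semidualizing of finite injective dimension. -/
def IsDualizing (R : Type u) [CommRing R] (D : Type u) [AddCommGroup D] [Module R D] : Prop :=
  IsSemidualizing R D ∧ ∃ n : ℕ, InjDimLE R n (ModuleCat.of R D)

/-- The depth of a local ring: the supremum of lengths of regular sequences contained in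
the maximal ideal. -/
def localRingDepth (A : Type u) [CommRing A] [IsLocalRing A] : ℕ∞ :=
  sSup {n : ℕ∞ | ∃ rs : List A, (∀ r ∈ rs, r ∈ IsLocalRing.maximalIdeal A) ∧
    RingTheory.Sequence.IsRegular A rs ∧ (rs.length : ℕ∞) = n}

/-- `R` is a Cohen-Macaulay ring: for each prime `p`, `depth (R_p) = dim (R_p)`. -/
def IsCohenMacaulayRing (R : Type u) [CommRing R] : Prop :=
  ∀ (p : Ideal R) (_ : p.IsPrime),
    (localRingDepth (Localization.AtPrime p) : WithBot ℕ∞) =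
      ringKrullDim (Localization.AtPrime p)

/-- Serre's condition `(S₁)`: `depth (R_p) ≥ min (ht p, 1)` for every prime `p`. -/
def SerreS1 (R : Type u) [CommRing R] : Prop :=
  ∀ (p : Ideal R) (hp : p.IsPrime),
    min (Order.height (⟨p, hp⟩ : PrimeSpectrum R)) 1 ≤ localRingDepth (Localization.AtPrime p)

/-- A Gorenstein local ring: a noetherian local ring of finite self-injective dimension. -/
def IsGorensteinLocalRing (A : Type u) [CommRing A] : Prop :=
  IsLocalRing A ∧ IsNoetherianRing A ∧ ∃ n : ℕ, InjDimLE A n (ModuleCat.of A A)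

/-- A minimal injective resolution `0 → D → J⁰ → J¹ → ⋯` of `D`: an exact sequence with all
`Jⁱ` injective, in which the kernel of each differential is an essential submodule. -/
structure MinimalInjRes (R : Type u) [CommRing R] (D : Type u) [AddCommGroup D]
    [Module R D] where
  J : ℕ → Type u
  [acg : ∀ i, AddCommGroup (J i)]
  [mod : ∀ i, Module R (J i)]
  ε : D →ₗ[R] J 0
  d : ∀ i, J i →ₗ[R] J (i + 1)
  inj : ∀ i, Module.Injective R (J i)
  ε_inj : Function.Injective ε
  exct0 : LinearMap.range ε = LinearMap.ker (d 0)
  exct : ∀ i, LinearMap.range (d i) = LinearMap.ker (d (i + 1))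
  minimal : ∀ i, ∀ K : Submodule R (J i), K ≠ ⊥ → K ⊓ LinearMap.ker (d i) ≠ ⊥

attribute [instance] MinimalInjRes.acg MinimalInjRes.mod

end

section Auxiliary

open TensorProduct

section Basics

variable {R : Type u} [CommRing R]

/-- `0 → A → B → Q → 0` is a short exact sequence of modules. -/
structure SES {A B Q : Type u} [AddCommGroup A] [Module R A] [AddCommGroup B] [Module R B]
    [AddCommGroup Q] [Module R Q] (f : A →ₗ[R] B) (g : B →ₗ[R] Q) : Prop where
  inj : Function.Injective f
  exact : Function.Exact f g
  surj : Function.Surjective g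

variable {A B N J : Type u} [AddCommGroup A] [Module R A] [AddCommGroup B] [Module R B]
  [AddCommGroup N] [Module R N] [AddCommGroup J] [Module R J]

theorem ses_ker {g : A →ₗ[R] B} (hg : Function.Surjective g) : SES (LinearMap.ker g).subtype g where
  inj := Subtype.val_injective
  exact := LinearMap.exact_subtype_ker_map g
  surj := hg

theorem ses_quot {f : A →ₗ[R] B} (hf : Function.Injective f) :
    SES f (LinearMap.range f).mkQ where
  inj := hf
  exact := LinearMap.exact_map_mkQ_range f
  surj := Submodule.mkQ_surjective _

theorem factor_of_surjective {f : A →ₗ[R] B} (hf : Function.Surjective f) (g : A →ₗ[R] N)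
    (h : ∀ x, f x = 0 → g x = 0) : ∃ k : B →ₗ[R] N, k ∘ₗ f = g := by
  refine ⟨(LinearMap.ker f).liftQ g (fun x hx => h x hx) ∘ₗ
    (f.quotKerEquivOfSurjective hf).symm.toLinearMap, ?_⟩
  ext x
  have : (f.quotKerEquivOfSurjective hf).symm (f x) = Submodule.Quotient.mk x := by
    rw [LinearEquiv.symm_apply_eq]; rfl
  simpa [this] using (LinearMap.ker f).liftQ_apply g x

theorem factor_of_injective {f : A →ₗ[R] B} (hf : Function.Injective f) (g : N →ₗ[R] B)
    (h : ∀ x, g x ∈ LinearMap.range f) : ∃ k : N →ₗ[R] A, f ∘ₗ k = g := by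
  refine ⟨(LinearEquiv.ofInjective f hf).symm.toLinearMap ∘ₗ g.codRestrict _ h, ?_⟩
  ext x
  have := (LinearEquiv.ofInjective f hf).apply_symm_apply (g.codRestrict _ h x)
  exact congrArg Subtype.val this

theorem factor_of_injective_module (hJ : Module.Injective R J) (f : A →ₗ[R] B) (g : A →ₗ[R] J)
    (h : ∀ x, f x = 0 → g x = 0) : ∃ k : B →ₗ[R] J, k ∘ₗ f = g := by
  obtain ⟨k, hk⟩ := factor_of_surjective f.surjective_rangeRestrict g
    (fun x hx => h x (congrArg Subtype.val hx))
  obtain ⟨l, hl⟩ := hJ.out (LinearMap.range f).subtype Subtype.val_injective k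
  refine ⟨l, ?_⟩
  rw [← hk]
  ext x
  exact hl (f.rangeRestrict x)

theorem extend_of_injective_module (hJ : Module.Injective R J) {f : A →ₗ[R] B}
    (hf : Function.Injective f) (g : A →ₗ[R] J) : ∃ k : B →ₗ[R] J, k ∘ₗ f = g :=
  factor_of_injective_module hJ f g fun x hx => by
    rw [hf (hx.trans (map_zero f).symm), map_zero]

variable (R) in
theorem exists_injective_embedding (N : Type u) [AddCommGroup N] [Module R N] :
    ∃ (E : ModuleCat.{u} R) (f : N →ₗ[R] E), Module.Injective R E ∧ Function.Injective f := by
  refine ⟨Injective.under (ModuleCat.of R N), (Injective.ι (ModuleCat.of R N)).hom, ?_, ?_⟩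
  · have : Injective (ModuleCat.of R (Injective.under (ModuleCat.of R N) : ModuleCat.{u} R)) :=
      inferInstanceAs (Injective (Injective.under (ModuleCat.of R N)))
    exact Module.injective_module_of_injective_object R _
  · exact (ModuleCat.mono_iff_injective _).1 inferInstance

theorem subsingleton_of_hom_injective
    (h : ∀ (E : ModuleCat.{u} R), Module.Injective R E → ∀ f : N →ₗ[R] E, f = 0) :
    Subsingleton N := by
  obtain ⟨E, f, hE, hf⟩ := exists_injective_embedding R N
  refine ⟨fun x y => hf ?_⟩
  rw [h E hE f]; rfl

theorem injective_of_equiv (e : N ≃ₗ[R] J) (h : Module.Injective R N) : Module.Injective R J where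
  out X Y _ _ _ _ f hf g := by
    obtain ⟨k, hk⟩ := h.out f hf (e.symm.toLinearMap ∘ₗ g)
    exact ⟨e.toLinearMap ∘ₗ k, fun x => by simp [hk]⟩

theorem injective_of_retract (i : N →ₗ[R] J) (r : J →ₗ[R] N) (hri : r ∘ₗ i = LinearMap.id)
    (h : Module.Injective R J) : Module.Injective R N where
  out X Y _ _ _ _ f hf g := by
    obtain ⟨k, hk⟩ := h.out f hf (i ∘ₗ g)
    exact ⟨r ∘ₗ k, fun x => by simpa [hk] using LinearMap.congr_fun hri (g x)⟩

theorem exists_free_cover (A : Type u) [AddCommGroup A] [Module R A] [Module.Finite R A] :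
    ∃ (n : ℕ) (π : (Fin n → R) →ₗ[R] A), Function.Surjective π :=
  Module.Finite.exists_fin' R A

theorem pi_decomp {n : ℕ} (x : Fin n → R) : ∑ i, x i • (Pi.single i 1 : Fin n → R) = x := by
  ext j
  simp [Finset.sum_apply, Pi.single_apply]

theorem exists_pi_lift {n : ℕ} {π : B →ₗ[R] A} (hπ : Function.Surjective π)
    (f : (Fin n → R) →ₗ[R] A) : ∃ g : (Fin n → R) →ₗ[R] B, π ∘ₗ g = f :=
  Module.projective_lifting_property π f hπ

end Basics

section TensorHom

variable {R : Type u} [CommRing R]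
variable (A N J : Type u) [AddCommGroup A] [Module R A]
  [AddCommGroup N] [Module R N] [AddCommGroup J] [Module R J]

/-- The evaluation map `A ⊗ Hom(N, J) → Hom(Hom(A, N), J)`. -/
def tensorHomEval : A ⊗[R] (N →ₗ[R] J) →ₗ[R] ((A →ₗ[R] N) →ₗ[R] J) :=
  TensorProduct.lift (LinearMap.mk₂ R (fun a φ => φ ∘ₗ LinearMap.applyₗ a)
    (fun a b φ => by ext; simp) (fun r a φ => by ext; simp)
    (fun a φ ψ => by ext; simp) (fun r a φ => by ext; simp))

@[simp] theorem tensorHomEval_tmul (a : A) (φ : N →ₗ[R] J) (l : A →ₗ[R] N) :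
    tensorHomEval A N J (a ⊗ₜ φ) l = φ (l a) := rfl

variable {A N J}
variable {B : Type u} [AddCommGroup B] [Module R B]

theorem tensorHomEval_rTensor (f : A →ₗ[R] B) (t : A ⊗[R] (N →ₗ[R] J)) (l : B →ₗ[R] N) :
    tensorHomEval B N J (f.rTensor _ t) l = tensorHomEval A N J t (l ∘ₗ f) := by
  induction t with
  | zero => simp
  | tmul a φ => simp
  | add x y hx hy => simp [hx, hy]

theorem tensorHomEval_pi (n : ℕ) : Function.Bijective (tensorHomEval (R := R) (Fin n → R) N J) := by
  constructor
  · rw [injective_iff_map_eq_zero]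
    intro t ht
    have key : ∀ t : (Fin n → R) ⊗[R] (N →ₗ[R] J), t = ∑ i, (Pi.single i 1 : Fin n → R) ⊗ₜ[R]
        ((tensorHomEval (R := R) (Fin n → R) N J t) ∘ₗ
          (LinearMap.smulRightₗ (LinearMap.proj i : (Fin n → R) →ₗ[R] R))) := by
      intro t
      induction t with
      | zero => simp
      | tmul a φ =>
        conv_lhs => rw [← pi_decomp a, TensorProduct.sum_tmul]
        refine Finset.sum_congr rfl fun i _ => ?_
        rw [TensorProduct.smul_tmul]
        congr 1
        ext y
        simp
      | add x y hx hy =>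
        conv_lhs => rw [hx, hy]
        rw [← Finset.sum_add_distrib]
        refine Finset.sum_congr rfl fun i _ => ?_
        rw [← TensorProduct.tmul_add]
        congr 1
        ext y
        simp
    rw [key t, ht]
    simp
  · intro Φ
    refine ⟨∑ i, (Pi.single i 1 : Fin n → R) ⊗ₜ[R] (Φ ∘ₗ
      (LinearMap.smulRightₗ (LinearMap.proj i : (Fin n → R) →ₗ[R] R))), ?_⟩
    ext l
    simp only [map_sum, LinearMap.sum_apply, tensorHomEval_tmul, LinearMap.comp_apply]
    rw [← map_sum]
    congr 1
    ext i
    simp [Finset.sum_apply, Pi.single_apply]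

theorem tensorHomEval_surjective [Module.Finite R A] (hJ : Module.Injective R J) :
    Function.Surjective (tensorHomEval (R := R) A N J) := by
  intro Φ
  obtain ⟨n, π, hπ⟩ := exists_free_cover (R := R) A
  obtain ⟨Ψ, hΨ⟩ := extend_of_injective_module hJ (f := LinearMap.lcomp R N π)
    (LinearMap.lcomp_injective_of_surjective π hπ) Φ
  obtain ⟨t, rfl⟩ := (tensorHomEval_pi n).2 Ψ
  refine ⟨π.rTensor _ t, ?_⟩
  rw [← hΨ]
  ext l
  rw [tensorHomEval_rTensor]
  rfl

theorem tensorHomEval_bijective [IsNoetherianRing R] [Module.Finite R A]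
    (hJ : Module.Injective R J) : Function.Bijective (tensorHomEval (R := R) A N J) := by
  refine ⟨?_, tensorHomEval_surjective hJ⟩
  rw [injective_iff_map_eq_zero]
  intro t ht
  obtain ⟨n, π, hπ⟩ := exists_free_cover (R := R) A
  obtain ⟨t, rfl⟩ := LinearMap.rTensor_surjective (N →ₗ[R] J) hπ t
  let K := LinearMap.ker π
  obtain ⟨Ψ, hΨ⟩ := factor_of_injective_module hJ (LinearMap.lcomp R N K.subtype)
    (tensorHomEval (R := R) (Fin n → R) N J t) (by
      intro l hl
      obtain ⟨k, rfl⟩ := factor_of_surjective hπ l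
        (fun x hx => LinearMap.congr_fun hl ⟨x, hx⟩)
      rw [← tensorHomEval_rTensor, ht]; rfl)
  obtain ⟨s, rfl⟩ := tensorHomEval_surjective (A := K) hJ Ψ
  have : t = K.subtype.rTensor _ s := by
    apply (tensorHomEval_pi n).1
    rw [← hΨ]
    ext l
    rw [tensorHomEval_rTensor]; rfl
  rw [this, ← LinearMap.comp_apply, ← LinearMap.rTensor_comp]
  have : π ∘ₗ K.subtype = 0 := by ext x; exact x.2
  rw [this]; simp

/-- If every map `A → N` extends along `f : A → B`, then `f ⊗ Hom(N, J)` is injective. -/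
theorem rTensor_hom_injective [IsNoetherianRing R] [Module.Finite R A] 
    (hJ : Module.Injective R J) (f : A →ₗ[R] B)
    (h : ∀ g : A →ₗ[R] N, ∃ k : B →ₗ[R] N, k ∘ₗ f = g) :
    Function.Injective (f.rTensor (N →ₗ[R] J)) := by
  rw [injective_iff_map_eq_zero]
  intro t ht
  apply (tensorHomEval_bijective (R := R) hJ).1
  ext l
  obtain ⟨k, rfl⟩ := h l
  rw [← tensorHomEval_rTensor, ht]
  simp

theorem flat_hom_of_injective [IsNoetherianRing R] (hN : Module.Injective R N)
    (hJ : Module.Injective R J) : Module.Flat R (N →ₗ[R] J) := by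
  rw [Module.Flat.iff_rTensor_injective']
  intro I
  exact rTensor_hom_injective hJ _ fun g =>
    extend_of_injective_module hN Subtype.val_injective g

end TensorHom

section HomTensor

variable {R : Type u} [CommRing R]
variable {P Q M F : Type u} [AddCommGroup P] [Module R P] [AddCommGroup Q] [Module R Q]
  [AddCommGroup M] [Module R M] [AddCommGroup F] [Module R F]

theorem rTensorHom_natural (f : P →ₗ[R] Q) (t : (Q →ₗ[R] M) ⊗[R] F) (x : P) :
    rTensorHomToHomRTensor (RingHom.id R) P M F ((LinearMap.lcomp R M f).rTensor F t) x =
      rTensorHomToHomRTensor (RingHom.id R) Q M F t (f x) := by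
  induction t with
  | zero => simp
  | tmul a φ => simp
  | add x y hx hy => simp [hx, hy]

theorem rTensorHom_pi (n : ℕ) :
    Function.Bijective (rTensorHomToHomRTensor (RingHom.id R) (Fin n → R) M F) := by
  rw [← rTensorHomEquivHomRTensor_toLinearMap]
  exact (rTensorHomEquivHomRTensor R (Fin n → R) M F).bijective

theorem rTensorHom_injective [Module.Finite R P] [Module.Flat R F] :
    Function.Injective (rTensorHomToHomRTensor (RingHom.id R) P M F) := by
  rw [injective_iff_map_eq_zero]
  intro t ht
  obtain ⟨n, π, hπ⟩ := exists_free_cover (R := R) P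
  apply Module.Flat.rTensor_preserves_injective_linearMap (M := F) (LinearMap.lcomp R M π)
    (LinearMap.lcomp_injective_of_surjective π hπ)
  apply (rTensorHom_pi n).1
  ext x
  simp [rTensorHom_natural, ht]

theorem lcomp_exact {K : Type u} [AddCommGroup K] [Module R K] {f : K →ₗ[R] P} {g : P →ₗ[R] Q}
    (hg : Function.Surjective g) (h : Function.Exact f g) :
    Function.Exact (LinearMap.lcomp R M g) (LinearMap.lcomp R M f) := by
  intro l
  constructor
  · intro hl
    obtain ⟨k, hk⟩ := factor_of_surjective hg l (by
      intro x hx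
      obtain ⟨y, rfl⟩ := (h x).1 hx
      exact LinearMap.congr_fun hl y)
    exact ⟨k, hk⟩
  · rintro ⟨k, rfl⟩
    ext x
    simp [h.apply_apply_eq_zero]

theorem rTensorHom_bijective [IsNoetherianRing R] [Module.Finite R P] [Module.Flat R F] :
    Function.Bijective (rTensorHomToHomRTensor (RingHom.id R) P M F) := by
  refine ⟨rTensorHom_injective, fun f => ?_⟩
  obtain ⟨n, π, hπ⟩ := exists_free_cover (R := R) P
  obtain ⟨t, ht⟩ := (rTensorHom_pi n).2 (f ∘ₗ π)
  let K := LinearMap.ker π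
  have h0 : (LinearMap.lcomp R M K.subtype).rTensor F t = 0 := by
    apply rTensorHom_injective
    ext x
    rw [rTensorHom_natural, ht]
    simp
  obtain ⟨s, rfl⟩ := (Module.Flat.rTensor_exact F
    (lcomp_exact (M := M) hπ (LinearMap.exact_subtype_ker_map π)) t).1 h0
  refine ⟨s, ?_⟩
  ext x
  obtain ⟨y, rfl⟩ := hπ x
  rw [← rTensorHom_natural, ht]; rfl

theorem rTensor_extend [IsNoetherianRing R] [Module.Finite R P] [Module.Flat R F]
    (f : P →ₗ[R] Q) (h : ∀ g : P →ₗ[R] M, ∃ k : Q →ₗ[R] M, k ∘ₗ f = g)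
    (g : P →ₗ[R] M ⊗[R] F) : ∃ k : Q →ₗ[R] M ⊗[R] F, k ∘ₗ f = g := by
  obtain ⟨t, rfl⟩ := rTensorHom_bijective.2 g
  obtain ⟨s, rfl⟩ := LinearMap.rTensor_surjective F (g := LinearMap.lcomp R M f) h t
  refine ⟨rTensorHomToHomRTensor (RingHom.id R) Q M F s, ?_⟩
  ext x
  simp [rTensorHom_natural]

theorem injective_tensor_flat [IsNoetherianRing R] [Module.Flat R F]
    (hM : Module.Injective R M) : Module.Injective R (M ⊗[R] F) := by
  rw [← Module.Baer.iff_injective]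
  intro I g
  obtain ⟨k, hk⟩ := rTensor_extend (F := F) I.subtype
    (extend_of_injective_module hM Subtype.val_injective) g
  exact ⟨k, fun x mem => LinearMap.congr_fun hk ⟨x, mem⟩⟩

end HomTensor

section ExtVanishing

variable {R : Type u} [CommRing R]

/-- The vanishing of `Ext^i(C, N)` for `1 ≤ i ≤ k`, expressed through extension of maps along
syzygies of `C`. -/
def ExtVanish (R : Type u) [CommRing R] (N : Type u) [AddCommGroup N] [Module R N] :
    ℕ → ∀ (C : Type u) [AddCommGroup C] [Module R C], Prop
  | 0, _, _, _ => True
  | k + 1, C, _, _ => ∀ (n : ℕ) (π : (Fin n → R) →ₗ[R] C), Function.Surjective π →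
      (∀ g : LinearMap.ker π →ₗ[R] N, ∃ h : (Fin n → R) →ₗ[R] N,
        h ∘ₗ (LinearMap.ker π).subtype = g) ∧ ExtVanish R N k (LinearMap.ker π)

/-- The vanishing of `Ext^i(C, N)` for all `i ≥ 1`. -/
def ExtAcyclic (R : Type u) [CommRing R] (C N : Type u) [AddCommGroup C] [Module R C]
    [AddCommGroup N] [Module R N] : Prop :=
  ∀ k, ExtVanish R N k C

variable {C N N₁ N₂ N₃ : Type u} [AddCommGroup C] [Module R C] [AddCommGroup N] [Module R N]
  [AddCommGroup N₁] [Module R N₁] [AddCommGroup N₂] [Module R N₂] [AddCommGroup N₃] [Module R N₃]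

theorem ExtAcyclic.extend (h : ExtAcyclic R C N) {n : ℕ} {π : (Fin n → R) →ₗ[R] C}
    (hπ : Function.Surjective π) (g : LinearMap.ker π →ₗ[R] N) :
    ∃ h : (Fin n → R) →ₗ[R] N, h ∘ₗ (LinearMap.ker π).subtype = g :=
  (h 1 n π hπ).1 g

theorem ExtAcyclic.syzygy (h : ExtAcyclic R C N) {n : ℕ} {π : (Fin n → R) →ₗ[R] C}
    (hπ : Function.Surjective π) : ExtAcyclic R (LinearMap.ker π) N :=
  fun k => (h (k + 1) n π hπ).2

theorem extAcyclic_of_injective (hN : Module.Injective R N) : ExtAcyclic R C N := by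
  intro k
  induction k generalizing C with
  | zero => trivial
  | succ k ih =>
    exact fun n π hπ => ⟨extend_of_injective_module hN Subtype.val_injective, ih⟩

theorem ExtAcyclic.congr (e : N₁ ≃ₗ[R] N₂) (h : ExtAcyclic R C N₁) : ExtAcyclic R C N₂ := by
  intro k
  induction k generalizing C with
  | zero => trivial
  | succ k ih =>
    intro n π hπ
    refine ⟨fun g => ?_, ih (h.syzygy hπ)⟩
    obtain ⟨l, hl⟩ := h.extend hπ (e.symm.toLinearMap ∘ₗ g)
    refine ⟨e.toLinearMap ∘ₗ l, ?_⟩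
    rw [LinearMap.comp_assoc, hl]
    ext x
    simp

theorem ExtAcyclic.exists_lift [Module.Finite R C] (h : ExtAcyclic R C N₁) {f : N₁ →ₗ[R] N₂}
    {g : N₂ →ₗ[R] N₃} (hs : SES f g) (l : C →ₗ[R] N₃) : ∃ k : C →ₗ[R] N₂, g ∘ₗ k = l := by
  obtain ⟨n, π, hπ⟩ := exists_free_cover (R := R) C
  obtain ⟨a, ha⟩ := exists_pi_lift hs.surj (l ∘ₗ π)
  obtain ⟨b, hb⟩ := factor_of_injective hs.inj (a ∘ₗ (LinearMap.ker π).subtype) (by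
    intro x
    refine (hs.exact _).1 ?_
    have := LinearMap.congr_fun ha x
    simpa using this)
  obtain ⟨c, hc⟩ := h.extend hπ b
  obtain ⟨k, hk⟩ := factor_of_surjective hπ (a - f ∘ₗ c) (by
    intro x hx
    have h1 := LinearMap.congr_fun hb ⟨x, hx⟩
    have h2 := LinearMap.congr_fun hc ⟨x, hx⟩
    simp only [LinearMap.comp_apply, Submodule.subtype_apply] at h1 h2
    simp [h2, h1])
  refine ⟨k, ?_⟩
  rw [← LinearMap.cancel_right hπ, LinearMap.comp_assoc, hk, LinearMap.comp_sub, ha,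
    ← LinearMap.comp_assoc, hs.exact.linearMap_comp_eq_zero]
  simp

theorem ExtAcyclic.coker [IsNoetherianRing R] [Module.Finite R C] {f : N₁ →ₗ[R] N₂}
    {g : N₂ →ₗ[R] N₃} (hs : SES f g) (h₁ : ExtAcyclic R C N₁) (h₂ : ExtAcyclic R C N₂) :
    ExtAcyclic R C N₃ := by
  intro k
  induction k generalizing C with
  | zero => trivial
  | succ k ih =>
    intro n π hπ
    refine ⟨fun l => ?_, ih (h₁.syzygy hπ) (h₂.syzygy hπ)⟩
    obtain ⟨a, rfl⟩ := (h₁.syzygy hπ).exists_lift hs l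
    obtain ⟨b, rfl⟩ := h₂.extend hπ a
    exact ⟨g ∘ₗ b, rfl⟩

theorem ExtAcyclic.kernel {f : N₁ →ₗ[R] N₂} {g : N₂ →ₗ[R] N₃} (hs : SES f g)
    (h₂ : ExtAcyclic R C N₂) (h₃ : ExtAcyclic R C N₃)
    (hl : ∀ l : C →ₗ[R] N₃, ∃ k : C →ₗ[R] N₂, g ∘ₗ k = l) : ExtAcyclic R C N₁ := by
  intro k
  induction k generalizing C with
  | zero => trivial
  | succ k ih =>
    intro n π hπ
    refine ⟨fun a => ?_, ih (h₂.syzygy hπ) (h₃.syzygy hπ) fun l => ?_⟩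
    · obtain ⟨b, hb⟩ := h₂.extend hπ (f ∘ₗ a)
      obtain ⟨c, hc⟩ := factor_of_surjective hπ (g ∘ₗ b) (by
        intro x hx
        have h1 := LinearMap.congr_fun hb ⟨x, hx⟩
        simp only [LinearMap.comp_apply, Submodule.subtype_apply] at h1
        simp [h1, hs.exact.apply_apply_eq_zero])
      obtain ⟨v, rfl⟩ := hl c
      obtain ⟨w, hw⟩ := factor_of_injective hs.inj (b - v ∘ₗ π) (by
        intro x
        refine (hs.exact _).1 ?_
        have := LinearMap.congr_fun hc x
        simp only [LinearMap.comp_apply] at this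
        simp [this])
      refine ⟨w, ?_⟩
      rw [← LinearMap.cancel_left hs.inj, ← LinearMap.comp_assoc, hw, ← hb]
      ext x
      simp
    · obtain ⟨a, rfl⟩ := h₃.extend hπ l
      obtain ⟨b, rfl⟩ := exists_pi_lift hs.surj a
      exact ⟨b ∘ₗ (LinearMap.ker π).subtype, rfl⟩

theorem subsingleton_ext_of_subsingleton_extM (i : ℕ) (h : Subsingleton (ExtM R (i + 1) C N)) :
    Subsingleton (Abelian.Ext (ModuleCat.of R C) (ModuleCat.of R N) (i + 1)) := by
  let P := ProjectiveResolution.of (ModuleCat.of R C)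
  have h1 : IsZero (ExtM R (i + 1) C N) := ModuleCat.isZero_of_subsingleton _
  have h2 := h1.of_iso (P.isoExt (R := R) (i + 1) (ModuleCat.of R N)).symm
  rw [← HomologicalComplex.exactAt_iff_isZero_homology,
    HomologicalComplex.exactAt_iff' _ i (i + 1) (i + 2) (by simp) (by simp),
    ShortComplex.moduleCat_exact_iff] at h2
  refine ⟨fun α β => ?_⟩
  have key : ∀ α : Abelian.Ext (ModuleCat.of R C) (ModuleCat.of R N) (i + 1), α = 0 := by
    intro α
    obtain ⟨f, hf, rfl⟩ := P.extMk_surjective α (i + 2) rfl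
    rw [P.extMk_eq_zero_iff f _ rfl hf i rfl]
    obtain ⟨g, hg⟩ := h2 f hf
    exact ⟨g, hg⟩
  rw [key α, key β]

theorem extAcyclic_of_subsingleton_ext
    (h : ∀ i, Subsingleton (Abelian.Ext (ModuleCat.of R C) (ModuleCat.of R N) (i + 1))) :
    ExtAcyclic R C N := by
  intro k
  induction k generalizing C with
  | zero => trivial
  | succ k ih =>
    intro n π hπ
    have hs := LinearMap.shortExact_shortComplexKer hπ
    have hproj : Projective (ModuleCat.of R (Fin n → R)) := inferInstance
    refine ⟨fun g => ?_, ih fun i => ⟨fun α β => ?_⟩⟩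
    · obtain ⟨x, hx⟩ := Abelian.Ext.contravariant_sequence_exact₁ hs (ModuleCat.of R N)
        (Abelian.Ext.mk₀ (ModuleCat.ofHom g)) (add_comm 1 0) (@Subsingleton.elim _ (h 0) _ _)
      obtain ⟨y, rfl⟩ := (Abelian.Ext.mk₀_bijective _ _).2 x
      rw [Abelian.Ext.mk₀_comp_mk₀] at hx
      have := (Abelian.Ext.mk₀_bijective _ _).1 hx
      exact ⟨y.hom, congrArg ModuleCat.Hom.hom this⟩
    · have key : ∀ α : Abelian.Ext (ModuleCat.of R (LinearMap.ker π)) (ModuleCat.of R N) (i + 1),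
          α = 0 := by
        intro α
        obtain ⟨x, rfl⟩ := Abelian.Ext.contravariant_sequence_exact₁ hs (ModuleCat.of R N)
          α (add_comm 1 (i + 1)) (@Subsingleton.elim _ (h (i + 1)) _ _)
        have hx : x = 0 := by
          have : Projective (LinearMap.shortComplexKer π).X₂ := hproj
          exact x.eq_zero_of_projective
        rw [hx, Abelian.Ext.comp_zero]
      rw [key α, key β]

theorem IsSemidualizing.extAcyclic (h : IsSemidualizing R C) : ExtAcyclic R C C :=
  extAcyclic_of_subsingleton_ext fun i => subsingleton_ext_of_subsingleton_extM i (h.2.2 _ (by omega))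

end ExtVanishing

section BassClass

variable {R : Type u} [CommRing R]

/-- `C ⊗ Hom(C, N) → N` behaves like an isomorphism when tested against maps to injectives, and
`Ext^i(C, N) = 0` for `i ≥ 1`. -/
structure WeakBass (R : Type u) [CommRing R] (C N : Type u) [AddCommGroup C] [Module R C]
    [AddCommGroup N] [Module R N] : Prop where
  acyclic : ExtAcyclic R C N
  eq_zero : ∀ (E : Type u) [AddCommGroup E] [Module R E], Module.Injective R E →
    ∀ f : N →ₗ[R] E, (∀ l : C →ₗ[R] N, f ∘ₗ l = 0) → f = 0
  exists_hom : ∀ (E : Type u) [AddCommGroup E] [Module R E], Module.Injective R E →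
    ∀ g : (C →ₗ[R] N) →ₗ[R] (C →ₗ[R] E), ∃ f : N →ₗ[R] E, ∀ l, g l = f ∘ₗ l

/-- The (elementary form of the) Bass class with respect to `C`. -/
structure BassClass (R : Type u) [CommRing R] (C N : Type u) [AddCommGroup C] [Module R C]
    [AddCommGroup N] [Module R N] : Prop extends WeakBass R C N where
  dual_acyclic : ∀ (E : Type u) [AddCommGroup E] [Module R E], Module.Injective R E →
    ExtAcyclic R C ((C →ₗ[R] N) →ₗ[R] E)

variable {C N J : Type u} [AddCommGroup C] [Module R C] [AddCommGroup N] [Module R N]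
  [AddCommGroup J] [Module R J]

theorem IsSemidualizing.finite (hC : IsSemidualizing R C) : Module.Finite R C := hC.1

theorem eval_bijective [IsNoetherianRing R] (hC : IsSemidualizing R C)
    (hJ : Module.Injective R J) : Function.Bijective
      (TensorProduct.lift (LinearMap.applyₗ : C →ₗ[R] (C →ₗ[R] J) →ₗ[R] J)) := by
  have := hC.finite
  let e : R ≃ₗ[R] (C →ₗ[R] C) := LinearEquiv.ofBijective
    (LinearMap.toSpanSingleton R (C →ₗ[R] C) LinearMap.id) hC.2.1
  let e' : ((C →ₗ[R] C) →ₗ[R] J) ≃ₗ[R] J :=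
    (LinearEquiv.congrLeft J R e.symm) ≪≫ₗ (LinearMap.ringLmapEquivSelf R R J)
  have : (TensorProduct.lift (LinearMap.applyₗ : C →ₗ[R] (C →ₗ[R] J) →ₗ[R] J)) =
      e'.toLinearMap ∘ₗ tensorHomEval (R := R) C C J := by
    ext c l
    simp only [e', e, LinearEquiv.congrLeft]
    change l c = l ((1 : R) • c)
    rw [one_smul]
  rw [this]
  exact e'.bijective.comp (tensorHomEval_bijective hJ)

theorem tensor_hom_ext {A L E : Type u} [AddCommGroup A] [Module R A] [AddCommGroup L] [Module R L]
    [AddCommGroup E] [Module R E] {f g : A ⊗[R] L →ₗ[R] E}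
    (h : ∀ a l, f (a ⊗ₜ l) = g (a ⊗ₜ l)) : f = g :=
  TensorProduct.ext' h

theorem weakBass_of_injective [IsNoetherianRing R] (hC : IsSemidualizing R C)
    (hJ : Module.Injective R J) : WeakBass R C J where
  acyclic := extAcyclic_of_injective hJ
  eq_zero E _ _ hE f hf := by
    rw [← LinearMap.cancel_right (eval_bijective hC hJ).2]
    refine tensor_hom_ext fun a l => ?_
    simpa using LinearMap.congr_fun (hf l) a
  exists_hom E _ _ hE g := by
    let ev := LinearEquiv.ofBijective _ (eval_bijective hC hJ)
    refine ⟨TensorProduct.lift (LinearMap.applyₗ : C →ₗ[R] (C →ₗ[R] E) →ₗ[R] E) ∘ₗ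
      g.lTensor C ∘ₗ ev.symm.toLinearMap, fun l => ?_⟩
    ext c
    have : ev.symm (l c) = c ⊗ₜ l := by
      rw [LinearEquiv.symm_apply_eq]; simp [ev]
    simp [this]

theorem dual_extAcyclic [IsNoetherianRing R] {A : Type u} [AddCommGroup A] [Module R A]
    [Module.Finite R A] (hJ : Module.Injective R J) (hA : ExtAcyclic R A C)
    {E : Type u} [AddCommGroup E] [Module R E] (hE : Module.Injective R E) :
    ExtAcyclic R A ((C →ₗ[R] J) →ₗ[R] E) := by
  intro k
  induction k generalizing A with
  | zero => trivial
  | succ k ih =>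
    intro n π hπ
    refine ⟨fun g => ?_, ih (hA.syzygy hπ)⟩
    obtain ⟨h, hh⟩ := extend_of_injective_module hE
      (A := LinearMap.ker π ⊗[R] (C →ₗ[R] J))
      (rTensor_hom_injective (N := C) hJ (LinearMap.ker π).subtype (hA.extend hπ))
      (TensorProduct.lift g)
    refine ⟨TensorProduct.curry h, ?_⟩
    ext x l
    exact LinearMap.congr_fun hh (x ⊗ₜ l)

theorem bassClass_of_injective [IsNoetherianRing R] (hC : IsSemidualizing R C)
    (hJ : Module.Injective R J) : BassClass R C J where
  toWeakBass := weakBass_of_injective hC hJ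
  dual_acyclic _ _ _ hE :=
    have := hC.finite
    dual_extAcyclic hJ hC.extAcyclic hE

theorem subsingleton_of_hom_semidualizing [IsNoetherianRing R] (hC : IsSemidualizing R C)
    (h : ∀ f : C →ₗ[R] N, f = 0) : Subsingleton N := by
  have := hC.finite
  refine subsingleton_of_forall_eq 0 fun x => ?_
  have h1 : Subsingleton (C →ₗ[R] (R ∙ x)) := by
    refine subsingleton_of_forall_eq 0 fun f => ?_
    exact (LinearMap.cancel_left (R ∙ x).injective_subtype).1 ((h _).trans (LinearMap.comp_zero _).symm)
  obtain ⟨r, hr, hr'⟩ := IsSMulRegular.subsingleton_linearMap_iff.1 h1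
  have h0 : r = 0 := by
    apply hC.2.1.1
    ext c
    simpa using Module.mem_annihilator.1 hr c
  have h2 : (⟨x, Submodule.mem_span_singleton_self x⟩ : R ∙ x) = 0 := hr' (by simp [h0])
  exact congrArg Subtype.val h2

variable {N₁ N₂ N₃ : Type u}
  [AddCommGroup N₁] [Module R N₁] [AddCommGroup N₂] [Module R N₂] [AddCommGroup N₃] [Module R N₃]

theorem WeakBass.congr (e : N₁ ≃ₗ[R] N₂) (h : WeakBass R C N₁) : WeakBass R C N₂ where
  acyclic := h.acyclic.congr e
  eq_zero E _ _ hE f hf := by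
    rw [← LinearMap.cancel_right e.surjective]
    exact (h.eq_zero E hE (f ∘ₗ e.toLinearMap) fun l => hf (e.toLinearMap ∘ₗ l)).trans (by simp)
  exists_hom E _ _ hE g := by
    obtain ⟨f, hf⟩ := h.exists_hom E hE (g ∘ₗ e.toLinearMap.compRight R)
    refine ⟨f ∘ₗ e.symm.toLinearMap, fun l => ?_⟩
    have := hf (e.symm.toLinearMap ∘ₗ l)
    rw [LinearMap.comp_assoc, ← this]
    simp only [LinearMap.comp_apply, LinearMap.compRight_apply]
    congr 1
    ext x
    simp

theorem WeakBass.coker [IsNoetherianRing R] [Module.Finite R C] {f : N₁ →ₗ[R] N₂}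
    {g : N₂ →ₗ[R] N₃} (hs : SES f g) (h₁ : WeakBass R C N₁) (h₂ : WeakBass R C N₂) :
    WeakBass R C N₃ where
  acyclic := ExtAcyclic.coker hs h₁.acyclic h₂.acyclic
  eq_zero E _ _ hE u hu := by
    rw [← LinearMap.cancel_right hs.surj]
    exact (h₂.eq_zero E hE (u ∘ₗ g) fun l => hu (g ∘ₗ l)).trans (by simp)
  exists_hom E _ _ hE v := by
    obtain ⟨u, hu⟩ := h₂.exists_hom E hE (v ∘ₗ g.compRight R)
    have h0 : u ∘ₗ f = 0 := h₁.eq_zero E hE _ fun l => by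
      rw [LinearMap.comp_assoc, ← hu]
      simp [← LinearMap.comp_assoc, hs.exact.linearMap_comp_eq_zero]
    obtain ⟨w, rfl⟩ := factor_of_surjective hs.surj u fun x hx => by
      obtain ⟨y, rfl⟩ := (hs.exact x).1 hx
      exact LinearMap.congr_fun h0 y
    refine ⟨w, fun l => ?_⟩
    obtain ⟨l, rfl⟩ := h₁.acyclic.exists_lift hs l
    rw [← LinearMap.comp_assoc, ← hu]; rfl

theorem BassClass.exists_lift [IsNoetherianRing R] (hC : IsSemidualizing R C)
    (h₂ : WeakBass R C N₂) (h₃ : WeakBass R C N₃) {g : N₂ →ₗ[R] N₃}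
    (hg : Function.Surjective g) (l : C →ₗ[R] N₃) : ∃ k : C →ₗ[R] N₂, g ∘ₗ k = l := by
  let H := (C →ₗ[R] N₃) ⧸ LinearMap.range (g.compRight R (M := C))
  have key : Subsingleton H := by
    refine subsingleton_of_hom_injective (R := R) fun E hE => ?_
    have : Subsingleton (H →ₗ[R] E) := subsingleton_of_hom_semidualizing hC fun φ => by
      obtain ⟨u, hu⟩ := h₃.exists_hom E hE (φ.flip ∘ₗ Submodule.mkQ _)
      have h0 : u = 0 := by
        rw [← LinearMap.cancel_right hg]
        refine (h₂.eq_zero E hE _ fun m => ?_).trans (by simp)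
        rw [LinearMap.comp_assoc, ← hu]
        have : Submodule.mkQ (LinearMap.range (g.compRight R (M := C))) (g ∘ₗ m) = 0 :=
          (Submodule.Quotient.mk_eq_zero _).2 ⟨m, rfl⟩
        simp only [LinearMap.comp_apply]
        rw [this, map_zero]
      ext c l
      have := LinearMap.congr_fun (hu l) c
      rw [h0] at this
      exact this
    exact fun f => Subsingleton.elim _ _
  have := Subsingleton.elim (Submodule.mkQ (LinearMap.range (g.compRight R (M := C))) l) 0
  exact (Submodule.Quotient.mk_eq_zero _).1 this

theorem ses_dual {f : N₁ →ₗ[R] N₂} {g : N₂ →ₗ[R] N₃} (hs : SES f g)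
    (hJ : Module.Injective R J) : SES (LinearMap.lcomp R J g) (LinearMap.lcomp R J f) where
  inj := LinearMap.lcomp_injective_of_surjective g hs.surj
  exact := lcomp_exact hs.surj hs.exact
  surj := extend_of_injective_module hJ hs.inj

theorem ses_hom {f : N₁ →ₗ[R] N₂} {g : N₂ →ₗ[R] N₃} (hs : SES f g)
    (hl : ∀ l : C →ₗ[R] N₃, ∃ k : C →ₗ[R] N₂, g ∘ₗ k = l) :
    SES (f.compRight R (M := C)) (g.compRight R (M := C)) where
  inj _ _ h := (LinearMap.cancel_left hs.inj).1 h
  exact l := by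
    constructor
    · intro h
      exact factor_of_injective hs.inj l fun x => (hs.exact _).1 (LinearMap.congr_fun h x)
    · rintro ⟨k, rfl⟩
      ext x
      simp [hs.exact.apply_apply_eq_zero]
  surj := hl

theorem BassClass.kernel [IsNoetherianRing R] (hC : IsSemidualizing R C) {f : N₁ →ₗ[R] N₂}
    {g : N₂ →ₗ[R] N₃} (hs : SES f g) (hN : Module.Injective R N₂) (h₃ : BassClass R C N₃) :
    BassClass R C N₁ := by
  have := hC.finite
  have h₂ := bassClass_of_injective hC hN
  have hl := BassClass.exists_lift hC h₂.toWeakBass h₃.toWeakBass hs.surj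
  have hsC := ses_hom hs hl
  refine ⟨⟨ExtAcyclic.kernel hs h₂.acyclic h₃.acyclic hl, ?_, ?_⟩, ?_⟩
  · intro E _ _ hE u hu
    obtain ⟨v, rfl⟩ := extend_of_injective_module hE hs.inj u
    obtain ⟨w, hw⟩ := factor_of_surjective hsC.surj (v.compRight R (M := C)) (by
      intro l hl
      obtain ⟨k, rfl⟩ := (hsC.exact l).1 hl
      exact hu k)
    obtain ⟨t, ht⟩ := h₃.exists_hom E hE w
    have h0 : v - t ∘ₗ g = 0 := h₂.eq_zero E hE _ fun l => by
      rw [LinearMap.sub_comp, LinearMap.comp_assoc, ← ht, sub_eq_zero]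
      exact (LinearMap.congr_fun hw l).symm
    rw [sub_eq_zero.1 h0, LinearMap.comp_assoc, hs.exact.linearMap_comp_eq_zero, LinearMap.comp_zero]
  · intro E _ _ hE u
    obtain ⟨v, hv⟩ := (h₃.dual_acyclic E hE).exists_lift (ses_dual hsC hE) u.flip
    obtain ⟨w, hw⟩ := h₂.exists_hom E hE v.flip
    refine ⟨w ∘ₗ f, fun l => ?_⟩
    rw [LinearMap.comp_assoc, ← hw]
    ext c
    have := LinearMap.congr_fun (LinearMap.congr_fun hv c) l
    exact this.symm
  · intro E _ _ hE
    exact ExtAcyclic.coker (ses_dual hsC hE) (h₃.dual_acyclic E hE) (h₂.dual_acyclic E hE)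

end BassClass

section InjDim

variable {R : Type u} [CommRing R]
variable {C N J : Type u} [AddCommGroup C] [Module R C] [AddCommGroup N] [Module R N]
  [AddCommGroup J] [Module R J]

theorem ses_equiv {A B Q : Type u} [AddCommGroup A] [Module R A] [AddCommGroup B] [Module R B]
    [AddCommGroup Q] [Module R Q] {f : A →ₗ[R] B} {g : B →ₗ[R] Q} (hs : SES f g) :
    Nonempty ((B ⧸ LinearMap.range f) ≃ₗ[R] Q) := by
  rw [← hs.exact.linearMap_ker_eq]
  exact ⟨g.quotKerEquivOfSurjective hs.surj⟩

theorem injDimLE_congr {n : ℕ} (e : N ≃ₗ[R] J) (h : InjDimLE R n (ModuleCat.of R N)) :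
    InjDimLE R n (ModuleCat.of R J) := by
  cases n with
  | zero => exact injective_of_equiv e h
  | succ n =>
    obtain ⟨I, hI, ι, hι, h⟩ := h
    refine ⟨I, hI, ι ∘ₗ e.symm.toLinearMap, hι.comp e.symm.injective, ?_⟩
    have : LinearMap.range (ι ∘ₗ e.symm.toLinearMap) = LinearMap.range ι :=
      LinearMap.range_comp_of_range_eq_top _ e.symm.range
    rw [this]
    exact h

theorem injDimLE_succ_of_ses {n : ℕ} {A B Q : Type u} [AddCommGroup A] [Module R A]
    [AddCommGroup B] [Module R B] [AddCommGroup Q] [Module R Q] {f : A →ₗ[R] B} {g : B →ₗ[R] Q}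
    (hs : SES f g) (hB : Module.Injective R B) (hQ : InjDimLE R n (ModuleCat.of R Q)) :
    InjDimLE R (n + 1) (ModuleCat.of R A) := by
  obtain ⟨e⟩ := ses_equiv hs
  exact ⟨ModuleCat.of R B, hB, f, hs.inj, injDimLE_congr e.symm hQ⟩

/-- Induction on the injective dimension. -/
theorem injDimLE_induction {P : ∀ (_ : ℕ) (N : Type u) [AddCommGroup N] [Module R N], Prop}
    (h0 : ∀ (N : Type u) [AddCommGroup N] [Module R N], Module.Injective R N → P 0 N)
    (h1 : ∀ (n : ℕ) (A B Q : Type u) [AddCommGroup A] [Module R A] [AddCommGroup B] [Module R B]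
      [AddCommGroup Q] [Module R Q] (f : A →ₗ[R] B) (g : B →ₗ[R] Q), SES f g →
      Module.Injective R B → InjDimLE R n (ModuleCat.of R Q) → P n Q → P (n + 1) A)
    {n : ℕ} (h : InjDimLE R n (ModuleCat.of R N)) : P n N := by
  induction n generalizing N with
  | zero => exact h0 N h
  | succ n ih =>
    obtain ⟨I, hI, ι, hι, h⟩ := h
    exact h1 n N I _ ι _ (ses_quot hι) hI h (ih h)

theorem injDimLE_tensor_flat [IsNoetherianRing R] {n : ℕ} (h : InjDimLE R n (ModuleCat.of R N))
    (F : Type u) [AddCommGroup F] [Module R F] [Module.Flat R F] :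
    InjDimLE R n (ModuleCat.of R (N ⊗[R] F)) := by
  refine injDimLE_induction
    (P := fun m N _ _ => InjDimLE R m (ModuleCat.of R (N ⊗[R] F))) ?_ ?_ h
  · intro N _ _ hN
    exact injective_tensor_flat hN
  · intro n A B Q _ _ _ _ _ _ f g hs hB hQ ih
    refine injDimLE_succ_of_ses (f := f.rTensor F) (g := g.rTensor F) ⟨?_, ?_, ?_⟩
      (injective_tensor_flat hB) ih
    · exact Module.Flat.rTensor_preserves_injective_linearMap f hs.inj
    · exact Module.Flat.rTensor_exact F hs.exact
    · exact LinearMap.rTensor_surjective F hs.surj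

theorem bassClass_of_injDimLE [IsNoetherianRing R] (hC : IsSemidualizing R C) {n : ℕ}
    (h : InjDimLE R n (ModuleCat.of R N)) : BassClass R C N :=
  injDimLE_induction (P := fun _ N _ _ => BassClass R C N)
    (fun _ _ _ hN => bassClass_of_injective hC hN)
    (fun _ _ _ _ _ _ _ _ _ _ _ _ hs hB _ ih => BassClass.kernel hC hs hB ih) h

end InjDim

section HomExact

variable {R : Type u} [CommRing R]
variable {X : ℤ → Type u} [∀ i, AddCommGroup (X i)] [∀ i, Module R (X i)]
  {d : ∀ i, X i →ₗ[R] X (i + 1)}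

/-- `Hom(L, X)` is exact. -/
def HomEx (d : ∀ i, X i →ₗ[R] X (i + 1)) (L : Type u) [AddCommGroup L] [Module R L] : Prop :=
  ∀ (i : ℤ) (g : L →ₗ[R] X (i + 1)), d (i + 1) ∘ₗ g = 0 → ∃ h : L →ₗ[R] X i, d i ∘ₗ h = g

/-- The terms of `X` are injective or of the form `Hom(C, I)` with `I` injective. -/
def IsICITerm (R : Type u) [CommRing R] (C T : Type u) [AddCommGroup C] [Module R C]
    [AddCommGroup T] [Module R T] : Prop :=
  Module.Injective R T ∨ ∃ (I : Type u) (_ : AddCommGroup I) (_ : Module R I),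
    Module.Injective R I ∧ Nonempty (T ≃ₗ[R] (C →ₗ[R] I))

variable {L L₁ L₂ L₃ : Type u} [AddCommGroup L] [Module R L]
  [AddCommGroup L₁] [Module R L₁] [AddCommGroup L₂] [Module R L₂] [AddCommGroup L₃] [Module R L₃]

theorem HomEx.congr (e : L₁ ≃ₗ[R] L₂) (h : HomEx d L₁) : HomEx d L₂ := by
  intro i g hg
  obtain ⟨k, hk⟩ := h i (g ∘ₗ e.toLinearMap) (by rw [← LinearMap.comp_assoc, hg, LinearMap.zero_comp])
  refine ⟨k ∘ₗ e.symm.toLinearMap, ?_⟩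
  rw [← LinearMap.comp_assoc, hk]
  ext x
  simp

theorem HomEx.coker (hd : ∀ i, d (i + 1) ∘ₗ d i = 0) {f : L₁ →ₗ[R] L₂} {p : L₂ →ₗ[R] L₃}
    (hs : SES f p) (hext : ∀ i (g : L₁ →ₗ[R] X i), ∃ k : L₂ →ₗ[R] X i, k ∘ₗ f = g)
    (h₁ : HomEx d L₁) (h₂ : HomEx d L₂) : HomEx d L₃ := by
  intro i g hg
  obtain ⟨h, hh⟩ := h₂ i (g ∘ₗ p) (by rw [← LinearMap.comp_assoc, hg, LinearMap.zero_comp])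
  obtain ⟨j, rfl⟩ : ∃ j, i = j + 1 := ⟨i - 1, by ring⟩
  obtain ⟨k, hk⟩ := h₁ j (h ∘ₗ f) (by
    rw [← LinearMap.comp_assoc, hh, LinearMap.comp_assoc, hs.exact.linearMap_comp_eq_zero,
      LinearMap.comp_zero])
  obtain ⟨k, rfl⟩ := hext j k
  obtain ⟨m, hm⟩ := factor_of_surjective hs.surj (h - d j ∘ₗ k) (by
    intro x hx
    obtain ⟨y, rfl⟩ := (hs.exact x).1 hx
    have := LinearMap.congr_fun hk y
    simp only [LinearMap.comp_apply] at this
    simp [this])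
  refine ⟨m, ?_⟩
  rw [← LinearMap.cancel_right hs.surj, LinearMap.comp_assoc, hm, LinearMap.comp_sub, hh,
    ← LinearMap.comp_assoc, hd, LinearMap.zero_comp, sub_zero]

theorem HomEx.kernel {f : L₁ →ₗ[R] L₂} {p : L₂ →ₗ[R] L₃}
    (hs : SES f p) (hext : ∀ i (g : L₁ →ₗ[R] X i), ∃ k : L₂ →ₗ[R] X i, k ∘ₗ f = g)
    (hd : ∀ i, d (i + 1) ∘ₗ d i = 0)
    (h₂ : HomEx d L₂) (h₃ : HomEx d L₃) : HomEx d L₁ := by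
  intro i g hg
  obtain ⟨g, rfl⟩ := hext (i + 1) g
  obtain ⟨m, hm⟩ := factor_of_surjective hs.surj (d (i + 1) ∘ₗ g) (by
    intro x hx
    obtain ⟨y, rfl⟩ := (hs.exact x).1 hx
    exact LinearMap.congr_fun hg y)
  obtain ⟨n, rfl⟩ := h₃ (i + 1) m (by
    rw [← LinearMap.cancel_right hs.surj, LinearMap.comp_assoc, hm, ← LinearMap.comp_assoc, hd,
      LinearMap.zero_comp, LinearMap.zero_comp])
  obtain ⟨h, hh⟩ := h₂ i (g - n ∘ₗ p) (by
    rw [LinearMap.comp_sub, ← LinearMap.comp_assoc, hm, sub_self])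
  refine ⟨h ∘ₗ f, ?_⟩
  rw [← LinearMap.comp_assoc, hh, LinearMap.sub_comp, LinearMap.comp_assoc,
    hs.exact.linearMap_comp_eq_zero, LinearMap.comp_zero, sub_zero]

theorem HomEx.tensor_projective (h : HomEx d L) (P : Type u) [AddCommGroup P] [Module R P]
    [Module.Projective R P] : HomEx d (L ⊗[R] P) := by
  intro i g hg
  let g' : P →ₗ[R] (L →ₗ[R] X (i + 1)) := (TensorProduct.curry g).flip
  have hg' : ∀ p, d (i + 1) ∘ₗ g' p = 0 := by
    intro p
    ext l
    exact LinearMap.congr_fun hg (l ⊗ₜ p)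
  obtain ⟨π, hπ⟩ : ∃ π : (P →₀ R) →ₗ[R] P, Function.Surjective π :=
    ⟨Finsupp.linearCombination R id, Finsupp.linearCombination_id_surjective R P⟩
  obtain ⟨s, hs⟩ := Module.projective_lifting_property π LinearMap.id hπ
  choose a ha using fun p : P => h i (g' (π (Finsupp.single p 1))) (hg' _)
  let b : (P →₀ R) →ₗ[R] (L →ₗ[R] X i) := Finsupp.linearCombination R a
  have hb : (d i).compRight R (M := L) ∘ₗ b = g' ∘ₗ π := by
    ext p l
    have := LinearMap.congr_fun (ha p) l
    simpa [b] using this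
  refine ⟨TensorProduct.lift (b ∘ₗ s).flip, tensor_hom_ext fun l p => ?_⟩
  have h1 := LinearMap.congr_fun (LinearMap.congr_fun hb (s p)) l
  have h2 : π (s p) = p := LinearMap.congr_fun hs p
  simp only [LinearMap.comp_apply, LinearMap.compRight_apply, h2] at h1
  simpa [g'] using h1

variable {C D J N N₁ N₂ : Type u} [AddCommGroup C] [Module R C] [AddCommGroup D] [Module R D]
  [AddCommGroup J] [Module R J] [AddCommGroup N] [Module R N] [AddCommGroup N₁] [Module R N₁]
  [AddCommGroup N₂] [Module R N₂]

theorem IsICITerm.extend {T : Type u} [AddCommGroup T] [Module R T] (hT : IsICITerm R C T)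
    (h₁ : WeakBass R C N₁) {f : N₁ →ₗ[R] N₂} (hf : Function.Injective f)
    (g : (C →ₗ[R] N₁) →ₗ[R] T) :
    ∃ k : (C →ₗ[R] N₂) →ₗ[R] T, k ∘ₗ f.compRight R (M := C) = g := by
  obtain hT | ⟨I, _, _, hI, ⟨e⟩⟩ := hT
  · exact extend_of_injective_module hT (fun _ _ h => (LinearMap.cancel_left hf).1 h) g
  · obtain ⟨u, hu⟩ := h₁.exists_hom I hI (e.toLinearMap ∘ₗ g)
    obtain ⟨v, rfl⟩ := extend_of_injective_module hI hf u
    refine ⟨e.symm.toLinearMap ∘ₗ v.compRight R (M := C), ?_⟩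
    ext l : 1
    have := hu l
    simp only [LinearMap.comp_apply, LinearEquiv.coe_coe] at this
    simp only [LinearMap.comp_apply, LinearEquiv.coe_coe, LinearEquiv.symm_apply_eq, this]
    rfl

theorem homEx_hom_of_injDimLE [IsNoetherianRing R] (hC : IsSemidualizing R C)
    (hd : ∀ i, d (i + 1) ∘ₗ d i = 0) (ht : ∀ i, IsICITerm R C (X i))
    (hX : ∀ (J : Type u) [AddCommGroup J] [Module R J], Module.Injective R J →
      HomEx d (C →ₗ[R] J))
    {n : ℕ} (hN : InjDimLE R n (ModuleCat.of R N)) : HomEx d (C →ₗ[R] N) := by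
  refine injDimLE_induction (P := fun _ N _ _ => HomEx d (C →ₗ[R] N)) ?_ ?_ hN
  · intro N _ _ hN
    exact hX N hN
  · intro n A B Q _ _ _ _ _ _ f g hs hB hQ ih
    have h₁ := bassClass_of_injDimLE hC (injDimLE_succ_of_ses hs hB hQ)
    have h₂ := bassClass_of_injective hC hB
    have h₃ := bassClass_of_injDimLE hC hQ
    exact HomEx.kernel (ses_hom hs (BassClass.exists_lift hC h₂.toWeakBass h₃.toWeakBass hs.surj))
      (fun i => (ht i).extend h₁.toWeakBass hs.inj) hd (hX B hB) ih

/-- The first syzygy of a module in its canonical free cover. -/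
noncomputable abbrev syz (R : Type u) [CommRing R] (F : ModuleCat.{u} R) : ModuleCat.{u} R :=
  ModuleCat.of R (LinearMap.ker (Finsupp.linearCombination R (id : F → F)))

/-- Iterated syzygies. -/
noncomputable def syzN (R : Type u) [CommRing R] (F : ModuleCat.{u} R) : ℕ → ModuleCat.{u} R
  | 0 => F
  | n + 1 => syz R (syzN R F n)

theorem ses_syz (F : ModuleCat.{u} R) :
    SES (A := syz R F) (B := F →₀ R) (Q := F) (LinearMap.ker _).subtype
      (Finsupp.linearCombination R (id : F → F)) :=
  ses_ker (Finsupp.linearCombination_id_surjective R F)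

theorem rTensor_injective_of_ses {A B Q M : Type u} [AddCommGroup A] [Module R A] [AddCommGroup B]
    [Module R B] [AddCommGroup Q] [Module R Q] [AddCommGroup M] [Module R M] {f : A →ₗ[R] B}
    {g : B →ₗ[R] Q} (hs : SES f g) [Module.Flat R Q] : Function.Injective (f.rTensor M) :=
  (LinearMap.lTensor_inj_iff_rTensor_inj _ _).1
    (LinearMap.lTensor_injective_of_exact_of_flat g hs.surj f hs.inj hs.exact M)

theorem flat_of_ses {A B Q : Type u} [AddCommGroup A] [Module R A] [AddCommGroup B]
    [Module R B] [AddCommGroup Q] [Module R Q] {f : A →ₗ[R] B}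
    {g : B →ₗ[R] Q} (hs : SES f g) [Module.Flat R Q] [Module.Flat R B] : Module.Flat R A := by
  rw [Module.Flat.iff_rTensor_injective']
  intro I
  have h1 : Function.Injective (f.lTensor I) :=
    LinearMap.lTensor_injective_of_exact_of_flat g hs.surj f hs.inj hs.exact I
  have h2 : Function.Injective (I.subtype.rTensor B) :=
    Module.Flat.rTensor_preserves_injective_linearMap _ Subtype.val_injective
  have h3 : f.lTensor R ∘ₗ I.subtype.rTensor A = I.subtype.rTensor B ∘ₗ f.lTensor I := by
    ext; rfl
  have h4 : Function.Injective (f.lTensor R ∘ₗ I.subtype.rTensor A) := by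
    rw [h3]; exact h2.comp h1
  exact Function.Injective.of_comp (f := f.lTensor R) h4

instance flat_syz (F : ModuleCat.{u} R) [Module.Flat R F] : Module.Flat R (syz R F) :=
  flat_of_ses (ses_syz F)

instance flat_syzN (F : ModuleCat.{u} R) [h : Module.Flat R F] (n : ℕ) :
    Module.Flat R (syzN R F n) := by
  induction n with
  | zero => exact h
  | succ n ih => exact flat_syz _

theorem syz_extend [IsNoetherianRing R] (hD : IsSemidualizing R D)
    (F : ModuleCat.{u} R) [Module.Flat R F] {n : ℕ} (hN : InjDimLE R n (ModuleCat.of R N))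
    (g : syzN R F (n + 1) →ₗ[R] (D →ₗ[R] N)) :
    ∃ k : (syzN R F n →₀ R) →ₗ[R] (D →ₗ[R] N), k ∘ₗ (LinearMap.ker _).subtype = g := by
  have base : ∀ (n : ℕ) (I : Type u) [AddCommGroup I] [Module R I], Module.Injective R I →
      ∀ g : syzN R F (n + 1) →ₗ[R] (D →ₗ[R] I),
      ∃ k : (syzN R F n →₀ R) →ₗ[R] (D →ₗ[R] I), k ∘ₗ (LinearMap.ker _).subtype = g := by
    intro n I _ _ hI g
    obtain ⟨k, hk⟩ := extend_of_injective_module hI (A := syzN R F (n + 1) ⊗[R] D)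
      (B := (syzN R F n →₀ R) ⊗[R] D)
      (rTensor_injective_of_ses (ses_syz (syzN R F n))) (TensorProduct.lift g)
    refine ⟨TensorProduct.curry k, ?_⟩
    ext x l
    exact LinearMap.congr_fun hk (x ⊗ₜ l)
  refine injDimLE_induction (P := fun n N _ _ => ∀ g : syzN R F (n + 1) →ₗ[R] (D →ₗ[R] N),
    ∃ k : (syzN R F n →₀ R) →ₗ[R] (D →ₗ[R] N), k ∘ₗ (LinearMap.ker _).subtype = g) ?_ ?_ hN g
  · intro N _ _ hN
    exact base 0 N hN
  · intro n A B Q _ _ _ _ _ _ f p hs hB hQ ih g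
    have hsD := ses_hom hs (BassClass.exists_lift hD (weakBass_of_injective hD hB)
      (bassClass_of_injDimLE hD hQ).toWeakBass hs.surj)
    have hsz := ses_syz (syzN R F (n + 1))
    obtain ⟨a, ha⟩ := base (n + 1) B hB (f.compRight R (M := D) ∘ₗ g)
    obtain ⟨b, hb⟩ := factor_of_surjective hsz.surj (p.compRight R (M := D) ∘ₗ a) (by
      intro x hx
      obtain ⟨y, rfl⟩ := (hsz.exact x).1 hx
      have := LinearMap.congr_fun ha y
      simp only [LinearMap.comp_apply] at this ⊢
      rw [this]
      exact hsD.exact.apply_apply_eq_zero _)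
    obtain ⟨c, hc⟩ := ih b
    obtain ⟨e, rfl⟩ := Module.projective_lifting_property _ c hsD.surj
    let q : (syzN R F (n + 1) →₀ R) →ₗ[R] (syzN R F n →₀ R) :=
      (LinearMap.ker (Finsupp.linearCombination R (id : syzN R F n → syzN R F n))).subtype ∘ₗ
        Finsupp.linearCombination R (id : syzN R F (n + 1) → syzN R F (n + 1))
    obtain ⟨v, hv⟩ := factor_of_injective hsD.inj (a - e ∘ₗ q) (by
      intro x
      refine (hsD.exact _).1 ?_
      have h1 := LinearMap.congr_fun hb x
      have h2 := LinearMap.congr_fun hc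
        (Finsupp.linearCombination R (id : syzN R F (n + 1) → syzN R F (n + 1)) x)
      rw [LinearMap.sub_apply, map_sub, sub_eq_zero]
      exact h1.symm.trans h2.symm)
    refine ⟨v, ?_⟩
    refine LinearMap.ext fun x => hsD.inj ?_
    have : q (x : syzN R F (n + 1) →₀ R) = 0 := by
      have hx : Finsupp.linearCombination R (id : syzN R F (n + 1) → syzN R F (n + 1))
        (x : syzN R F (n + 1) →₀ R) = 0 := x.2
      exact congrArg Subtype.val hx
    have h1 := LinearMap.congr_fun hv (x : syzN R F (n + 1) →₀ R)
    rw [LinearMap.sub_apply, LinearMap.comp_apply e, this, map_zero, sub_zero] at h1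
    exact h1.trans (LinearMap.congr_fun ha x)

theorem equiv_hom_tensor [IsNoetherianRing R] (hD : IsSemidualizing R D) (K : Type u)
    [AddCommGroup K] [Module R K] [Module.Flat R K] : Nonempty (K ≃ₗ[R] (D →ₗ[R] D ⊗[R] K)) := by
  have := hD.finite
  exact ⟨(TensorProduct.lid R K).symm ≪≫ₗ
    TensorProduct.congr (LinearEquiv.ofBijective
      (LinearMap.toSpanSingleton R (D →ₗ[R] D) LinearMap.id) hD.2.1) (LinearEquiv.refl R K) ≪≫ₗ
    LinearEquiv.ofBijective _ (rTensorHom_bijective (P := D) (M := D) (F := K))⟩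

theorem projective_syzN [IsNoetherianRing R] (hD : IsSemidualizing R D) {n : ℕ}
    (hn : InjDimLE R n (ModuleCat.of R D)) (F : ModuleCat.{u} R) [Module.Flat R F] :
    Module.Projective R (syzN R F (n + 1)) := by
  obtain ⟨e⟩ := equiv_hom_tensor hD (syzN R F (n + 1))
  obtain ⟨k, hk⟩ := syz_extend hD F (injDimLE_tensor_flat hn (syzN R F (n + 1))) e.toLinearMap
  refine Module.Projective.of_split (M := syzN R F n →₀ R) (P := syzN R F (n + 1))
    (LinearMap.ker _).subtype (e.symm.toLinearMap ∘ₗ k) (LinearMap.ext fun x => ?_)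
  exact (e.symm_apply_eq).2 (LinearMap.congr_fun hk x)

theorem homEx_tensor_flat [IsNoetherianRing R] (hC : IsSemidualizing R C) (hD : IsDualizing R D)
    (hd : ∀ i, d (i + 1) ∘ₗ d i = 0) (ht : ∀ i, IsICITerm R C (X i))
    (hX : HomEx d (C →ₗ[R] D)) (F : ModuleCat.{u} R) [Module.Flat R F] :
    HomEx d (C →ₗ[R] D ⊗[R] F) := by
  have := hC.finite
  obtain ⟨hD, n, hn⟩ := hD
  have proj : ∀ (P : Type u) [AddCommGroup P] [Module R P] [Module.Projective R P],
      HomEx d (C →ₗ[R] D ⊗[R] P) := fun P _ _ _ =>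
    (hX.tensor_projective P).congr
      (LinearEquiv.ofBijective _ (rTensorHom_bijective (P := C) (M := D) (F := P)))
  have key : ∀ k, HomEx d (C →ₗ[R] D ⊗[R] syzN R F k) → HomEx d (C →ₗ[R] D ⊗[R] F) := by
    intro k hk
    induction k with
    | zero => exact hk
    | succ k ih =>
      apply ih
      have hs := ses_syz (syzN R F k)
      have hsD : SES (R := R) (A := D ⊗[R] syzN R F (k + 1)) (B := D ⊗[R] (syzN R F k →₀ R))
          (Q := D ⊗[R] syzN R F k) (LinearMap.lTensor D (LinearMap.ker _).subtype)
          (LinearMap.lTensor D (Finsupp.linearCombination R (id : syzN R F k → syzN R F k))) :=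
        ⟨LinearMap.lTensor_injective_of_exact_of_flat _ hs.surj _ hs.inj hs.exact D,
          lTensor_exact D hs.exact hs.surj, LinearMap.lTensor_surjective D hs.surj⟩
      have hB := (bassClass_of_injDimLE hC
        (injDimLE_tensor_flat hn (syzN R F (k + 1)))).toWeakBass
      exact HomEx.coker hd (ses_hom hsD (hB.acyclic.exists_lift hsD))
        (fun i => (ht i).extend hB hsD.inj) hk (proj _)
  have := projective_syzN hD hn F
  exact key (n + 1) (proj _)

theorem homEx_of_homEx_dualizing [IsNoetherianRing R] (hC : IsSemidualizing R C)
    (hD : IsDualizing R D)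
    (hd : ∀ i, d (i + 1) ∘ₗ d i = 0) (ht : ∀ i, IsICITerm R C (X i))
    (hX : HomEx d (C →ₗ[R] D)) (hJ : Module.Injective R J) : HomEx d (C →ₗ[R] J) := by
  have := hC.finite
  have hD' := hD
  obtain ⟨hDs, n, hn⟩ := hD
  have := hDs.finite
  have key : WeakBass R C ((D →ₗ[R] D) →ₗ[R] J) ∧ HomEx d (C →ₗ[R] ((D →ₗ[R] D) →ₗ[R] J)) := by
    refine injDimLE_induction (P := fun _ N _ _ => WeakBass R C ((D →ₗ[R] N) →ₗ[R] J) ∧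
      HomEx d (C →ₗ[R] ((D →ₗ[R] N) →ₗ[R] J))) ?_ ?_ hn
    · intro N _ _ hN
      let e := LinearEquiv.ofBijective _ (tensorHomEval_bijective (A := D) (N := N) hJ)
      have := flat_hom_of_injective hN hJ
      exact ⟨(bassClass_of_injDimLE hC (injDimLE_tensor_flat hn (N →ₗ[R] J))).toWeakBass.congr e,
        (homEx_tensor_flat hC hD' hd ht hX (ModuleCat.of R (N →ₗ[R] J))).congr
          (e.congrRight)⟩
    · intro n A B Q _ _ _ _ _ _ f p hs hB hQ ih
      have hsD := ses_dual (J := J) (ses_hom hs (BassClass.exists_lift hDs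
        (weakBass_of_injective hDs hB) (bassClass_of_injDimLE hDs hQ).toWeakBass hs.surj)) hJ
      have hBW : WeakBass R C ((D →ₗ[R] B) →ₗ[R] J) ∧
          HomEx d (C →ₗ[R] ((D →ₗ[R] B) →ₗ[R] J)) := by
        let e := LinearEquiv.ofBijective _ (tensorHomEval_bijective (A := D) (N := B) hJ)
        have := flat_hom_of_injective hB hJ
        exact ⟨(bassClass_of_injDimLE hC
          (injDimLE_tensor_flat hn (B →ₗ[R] J))).toWeakBass.congr e,
          (homEx_tensor_flat hC hD' hd ht hX (ModuleCat.of R (B →ₗ[R] J))).congr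
            (e.congrRight)⟩
      exact ⟨WeakBass.coker hsD ih.1 hBW.1,
        HomEx.coker hd (ses_hom hsD (ih.1.acyclic.exists_lift hsD))
          (fun i => (ht i).extend ih.1 hsD.inj) ih.2 hBW.2⟩
  let e : R ≃ₗ[R] (D →ₗ[R] D) := LinearEquiv.ofBijective
    (LinearMap.toSpanSingleton R (D →ₗ[R] D) LinearMap.id) hDs.2.1
  exact key.2.congr
    ((LinearEquiv.congrLeft J R e.symm) ≪≫ₗ (LinearMap.ringLmapEquivSelf R R J)).congrRight

end HomExact

section Torsion

variable {R : Type u} [CommRing R]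
variable {N N' M I T : Type u} [AddCommGroup N] [Module R N] [AddCommGroup N'] [Module R N']
  [AddCommGroup M] [Module R M] [AddCommGroup I] [Module R I] [AddCommGroup T] [Module R T]

/-- The submodule of elements of `N` that vanish in the localization at each prime of `U`. -/
def gam (U : Set (PrimeSpectrum R)) (N : Type u) [AddCommGroup N] [Module R N] :
    Submodule R N where
  carrier := {x | ∀ q ∈ U, ∃ s, s ∉ q.asIdeal ∧ s • x = 0}
  zero_mem' q _ := ⟨1, q.asIdeal.ne_top_iff_one.1 q.2.ne_top, smul_zero _⟩
  add_mem' := by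
    intro x y hx hy q hq
    obtain ⟨s, hs, hsx⟩ := hx q hq
    obtain ⟨t, ht, hty⟩ := hy q hq
    refine ⟨s * t, fun h => (q.2.mem_or_mem h).elim hs ht, ?_⟩
    rw [smul_add, mul_smul, mul_smul, hty, smul_zero, smul_comm, hsx, smul_zero, add_zero]
  smul_mem' := by
    intro r x hx q hq
    obtain ⟨s, hs, hsx⟩ := hx q hq
    exact ⟨s, hs, by rw [smul_comm, hsx, smul_zero]⟩

theorem gam_anti {U V : Set (PrimeSpectrum R)} (h : U ⊆ V) : gam V N ≤ gam U N :=
  fun _ hx q hq => hx q (h hq)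

theorem map_mem_gam {U : Set (PrimeSpectrum R)} (f : N →ₗ[R] N') {x : N} (hx : x ∈ gam U N) :
    f x ∈ gam U N' := fun q hq => by
  obtain ⟨s, hs, hsx⟩ := hx q hq
  exact ⟨s, hs, by rw [← map_smul, hsx, map_zero]⟩

theorem mem_gam_of_injective {U : Set (PrimeSpectrum R)} {f : N →ₗ[R] N'}
    (hf : Function.Injective f) {x : N} (hx : f x ∈ gam U N') : x ∈ gam U N := fun q hq => by
  obtain ⟨s, hs, hsx⟩ := hx q hq
  exact ⟨s, hs, hf (by rw [map_smul, hsx, map_zero])⟩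

/-- The map induced on `gam U`. -/
def gamMap (U : Set (PrimeSpectrum R)) (f : N →ₗ[R] N') : gam U N →ₗ[R] gam U N' :=
  f.restrict fun _ hx => map_mem_gam f hx

/-- The equivalence induced on `gam U`. -/
def gamEquiv (U : Set (PrimeSpectrum R)) (e : N ≃ₗ[R] N') : gam U N ≃ₗ[R] gam U N' :=
  LinearEquiv.ofLinearMap (gamMap U e.toLinearMap) (gamMap U e.symm.toLinearMap)
    (LinearMap.ext fun x => Subtype.ext (e.apply_symm_apply x))
    (LinearMap.ext fun x => Subtype.ext (e.symm_apply_apply x))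

theorem exists_smul_eq_zero_of_fg {U : Set (PrimeSpectrum R)} {P : Submodule R N} (hP : P.FG)
    (hle : P ≤ gam U N) {q : PrimeSpectrum R} (hq : q ∈ U) :
    ∃ s, s ∉ q.asIdeal ∧ ∀ x ∈ P, s • x = 0 := by
  induction P, hP using Submodule.fg_induction with
  | singleton x =>
    obtain ⟨s, hs, hsx⟩ := hle (Submodule.mem_span_singleton_self x) q hq
    refine ⟨s, hs, fun y hy => ?_⟩
    obtain ⟨r, rfl⟩ := Submodule.mem_span_singleton.1 hy
    rw [smul_comm, hsx, smul_zero]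
  | sup P Q _ _ hP hQ =>
    obtain ⟨s, hs, hsx⟩ := hP (le_sup_left.trans hle)
    obtain ⟨t, ht, hty⟩ := hQ (le_sup_right.trans hle)
    refine ⟨s * t, fun h => (q.2.mem_or_mem h).elim hs ht, fun x hx => ?_⟩
    obtain ⟨y, hy, z, hz, rfl⟩ := Submodule.mem_sup.1 hx
    rw [smul_add, mul_smul, mul_smul, hty z hz, smul_zero, smul_comm, hsx y hy, smul_zero,
      add_zero]

theorem injective_gam [IsNoetherianRing R] (U : Set (PrimeSpectrum R))
    (hI : Module.Injective R I) : Module.Injective R (gam U I) := by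
  refine Module.Baer.injective fun a f => ?_
  let g : a →ₗ[R] I := (gam U I).subtype ∘ₗ f
  have hfg : (LinearMap.range g).FG := by
    rw [← Submodule.map_top]
    exact Submodule.FG.map _ Module.Finite.fg_top
  have hle : LinearMap.range g ≤ gam U I := by
    rintro _ ⟨x, rfl⟩
    exact (f x).2
  let b : Ideal R := Module.annihilator R (LinearMap.range g)
  have hb : ∀ s ∈ b, ∀ x, s • g x = 0 := fun s hs x =>
    congrArg Subtype.val (Module.mem_annihilator.1 hs ⟨g x, x, rfl⟩)
  obtain ⟨k, hk⟩ := Ideal.exists_pow_inf_eq_pow_smul b (M := R) a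
  have hg : ∀ x : a, (b ^ (k + 1)).mkQ x = 0 → g x = 0 := by
    intro x hx
    have hx' : (x : R) ∈ b ^ (k + 1) := by
      rwa [Submodule.mkQ_apply, Submodule.Quotient.mk_eq_zero] at hx
    have h1 : (x : R) ∈ b ^ (k + 1) • (⊤ : Ideal R) ⊓ a := ⟨by simpa using hx', x.2⟩
    rw [hk (k + 1) (by omega), Nat.add_sub_cancel_left, pow_one] at h1
    have h2 : (x : R) ∈ b • a := Submodule.smul_mono le_rfl inf_le_right h1
    have h3 : b • a ≤ (LinearMap.ker g).map a.subtype := Submodule.smul_le.2 fun r hr n hn =>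
      ⟨r • ⟨n, hn⟩, LinearMap.mem_ker.2 ((map_smul g r _).trans (hb r hr _)), rfl⟩
    obtain ⟨y, hy, hyx⟩ := h3 h2
    obtain rfl : y = x := Subtype.ext hyx
    exact hy
  obtain ⟨l, hl⟩ := factor_of_injective_module hI ((b ^ (k + 1)).mkQ ∘ₗ a.subtype) g hg
  have hmem : ∀ x, l x ∈ gam U I := by
    intro x q hq
    obtain ⟨s, hs, hsx⟩ := exists_smul_eq_zero_of_fg hfg hle hq
    have hsb : s ∈ b := Module.mem_annihilator.2 fun y => Subtype.ext (hsx y y.2)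
    refine ⟨s ^ (k + 1), fun h => hs (q.2.mem_of_pow_mem _ h), ?_⟩
    obtain ⟨r, rfl⟩ := Submodule.mkQ_surjective _ x
    rw [← map_smul, ← map_smul, Submodule.mkQ_apply, (Submodule.Quotient.mk_eq_zero _).2, map_zero]
    exact Ideal.mul_mem_right _ _ (Ideal.pow_mem_pow hsb _)
  refine ⟨(l ∘ₗ (b ^ (k + 1)).mkQ).codRestrict _ fun x => hmem _, fun x hx => Subtype.ext ?_⟩
  exact LinearMap.congr_fun hl ⟨x, hx⟩

theorem gam_hom_eq_range [Module.Finite R M] (U : Set (PrimeSpectrum R)) :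
    LinearMap.range ((gam U I).subtype.compRight R (M := M)) = gam U (M →ₗ[R] I) := by
  apply le_antisymm
  · rintro _ ⟨φ, rfl⟩ q hq
    obtain ⟨s, hs, hsx⟩ := exists_smul_eq_zero_of_fg (P := (LinearMap.range φ).map (gam U I).subtype)
      (by rw [← Submodule.map_top, ← Submodule.map_comp]; exact Submodule.FG.map _ Module.Finite.fg_top)
      (by rintro _ ⟨x, _, rfl⟩; exact x.2) hq
    refine ⟨s, hs, ?_⟩
    ext m
    exact hsx _ ⟨φ m, ⟨m, rfl⟩, rfl⟩
  · intro φ hφ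
    refine ⟨φ.codRestrict _ fun m q hq => ?_, rfl⟩
    obtain ⟨s, hs, hsx⟩ := hφ q hq
    exact ⟨s, hs, LinearMap.congr_fun hsx m⟩

theorem compRight_subtype_injective (U : Set (PrimeSpectrum R)) :
    Function.Injective ((gam U I).subtype.compRight R (M := M)) :=
  fun _ _ h => (LinearMap.cancel_left Subtype.val_injective).1 h

/-- `gam U` commutes with `Hom(M, -)` for `M` finitely generated. -/
noncomputable def gamHomEquiv [Module.Finite R M] (U : Set (PrimeSpectrum R)) :
    gam U (M →ₗ[R] I) ≃ₗ[R] (M →ₗ[R] gam U I) :=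
  (LinearEquiv.ofEq _ _ (gam_hom_eq_range U).symm) ≪≫ₗ
    (LinearEquiv.ofInjective _ (compRight_subtype_injective U)).symm

/-- Modules of the form `Hom(M, I)` with `M` finitely generated and `I` injective. -/
def IsHI (R : Type u) [CommRing R] (T : Type u) [AddCommGroup T] [Module R T] : Prop :=
  ∃ (M I : ModuleCat.{u} R), Module.Finite R M ∧ Module.Injective R I ∧ Nonempty (T ≃ₗ[R] (M →ₗ[R] I))

theorem IsHI.torsion [IsNoetherianRing R] (h : IsHI R T) (U : Set (PrimeSpectrum R)) :
    IsHI R (gam U T) := by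
  obtain ⟨M, I, hM, hI, ⟨e⟩⟩ := h
  exact ⟨M, ModuleCat.of R (gam U I), hM, injective_gam U hI,
    ⟨gamEquiv U e ≪≫ₗ gamHomEquiv U⟩⟩

/-- Every element of `T` becomes divisible by powers of `x` after multiplication by a power
of `x`. -/
def IsGood (x : R) (T : Type u) [AddCommGroup T] [Module R T] : Prop :=
  ∀ (w : T) (m : ℕ), ∃ (u : T) (k : ℕ), x ^ (k + m) • u = x ^ k • w

theorem IsGood.of_surjective {x : R} (h : IsGood x N) {f : N →ₗ[R] N'}
    (hf : Function.Surjective f) : IsGood x N' := by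
  intro w m
  obtain ⟨w, rfl⟩ := hf w
  obtain ⟨u, k, hu⟩ := h w m
  exact ⟨f u, k, by rw [← map_smul, hu, map_smul]⟩

theorem IsHI.isGood [IsNoetherianRing R] (h : IsHI R T) (x : R) : IsGood x T := by
  obtain ⟨M, I, hM, hI, ⟨e⟩⟩ := h
  refine IsGood.of_surjective (f := e.symm.toLinearMap) (fun φ m => ?_) e.symm.surjective
  let K : ℕ →o Submodule R M :=
    ⟨fun n => LinearMap.ker (LinearMap.lsmul R M (x ^ n)), by
      intro a b hab y hy
      obtain ⟨c, rfl⟩ := Nat.exists_eq_add_of_le' hab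
      have hy : x ^ a • y = 0 := hy
      change x ^ (c + a) • y = 0
      rw [pow_add, mul_smul, hy, smul_zero]⟩
  obtain ⟨k, hk⟩ := monotone_stabilizes_iff_noetherian.2 (inferInstanceAs (IsNoetherian R M)) K
  obtain ⟨ψ, hψ⟩ := factor_of_injective_module hI (LinearMap.lsmul R M (x ^ (k + m)))
    (φ ∘ₗ LinearMap.lsmul R M (x ^ k)) (by
      intro y hy
      have hy' : y ∈ K k := by
        rw [hk (k + m) (by omega)]; exact hy
      have hy' : LinearMap.lsmul R M (x ^ k) y = 0 := hy'
      rw [LinearMap.comp_apply, hy', map_zero])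
  refine ⟨ψ, k, ?_⟩
  ext y
  have := LinearMap.congr_fun hψ y
  simp only [LinearMap.comp_apply, LinearMap.lsmul_apply, map_smul] at this
  exact this

theorem le_radical_annihilator_of_mem_gam {a : Ideal R} {x : N}
    (hx : x ∈ gam {q : PrimeSpectrum R | ¬ a ≤ q.asIdeal} N) :
    a ≤ Ideal.radical (LinearMap.ker (LinearMap.toSpanSingleton R N x)) := by
  rw [Ideal.radical_eq_sInf]
  refine le_sInf fun q ⟨hq, hqp⟩ => ?_
  by_contra ha
  obtain ⟨s, hs, hsx⟩ := hx ⟨q, hqp⟩ ha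
  exact hs (hq hsx)

theorem exists_pow_smul_of_mem_gam {r : R} {x : N}
    (hx : x ∈ gam {q : PrimeSpectrum R | r ∉ q.asIdeal} N) : ∃ k : ℕ, r ^ k • x = 0 := by
  have : x ∈ gam {q : PrimeSpectrum R | ¬ Ideal.span {r} ≤ q.asIdeal} N := by
    simpa only [Ideal.span_singleton_le_iff_mem] using hx
  exact le_radical_annihilator_of_mem_gam this (Ideal.mem_span_singleton_self r)

theorem mem_gam_of_pow_smul {r : R} {x : N} {k : ℕ} (hx : r ^ k • x = 0) :
    x ∈ gam {q : PrimeSpectrum R | r ∉ q.asIdeal} N :=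
  fun q hq => ⟨r ^ k, fun h => hq (q.2.mem_of_pow_mem _ h), hx⟩

variable {Y : ℤ → Type u} [∀ i, AddCommGroup (Y i)] [∀ i, Module R (Y i)]
  {d : ∀ i, Y i →ₗ[R] Y (i + 1)}

theorem exists_pow_smul_lift {r : R} (hY : ∀ i, IsGood r (Y i))
    (hd : ∀ i y, d (i + 1) (d i y) = 0) (hex : ∀ i y, d (i + 1) y = 0 → ∃ z, d i z = y)
    (i : ℤ) (y : Y (i + 1)) (hdy : d (i + 1) y = 0) {k : ℕ} (hy : r ^ k • y = 0) :
    ∃ z, d i z = y ∧ ∃ l : ℕ, r ^ l • z = 0 := by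
  obtain ⟨j, rfl⟩ : ∃ j, i = j + 1 := ⟨i - 1, by ring⟩
  obtain ⟨z, rfl⟩ := hex _ y hdy
  obtain ⟨w, hw⟩ := hex _ (r ^ k • z) (by rw [map_smul, hy])
  obtain ⟨v, l, hv⟩ := hY _ w k
  refine ⟨z - d j v, by rw [map_sub, hd, sub_zero], l + k, ?_⟩
  rw [smul_sub, ← map_smul, hv, map_smul, hw, pow_add, mul_smul, sub_self]

theorem exists_pow_smul_list_lift [IsNoetherianRing R] (l : List R)
    (hY : ∀ i, IsHI R (Y i))
    (hd : ∀ i y, d (i + 1) (d i y) = 0) (hex : ∀ i y, d (i + 1) y = 0 → ∃ z, d i z = y)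
    (i : ℤ) (y : Y (i + 1)) (hdy : d (i + 1) y = 0) (hy : ∀ r ∈ l, ∃ k : ℕ, r ^ k • y = 0) :
    ∃ z, d i z = y ∧ ∀ r ∈ l, ∃ k : ℕ, r ^ k • z = 0 := by
  induction l generalizing Y with
  | nil =>
    obtain ⟨z, hz⟩ := hex i y hdy
    exact ⟨z, hz, by simp⟩
  | cons r l ih =>
    obtain ⟨k, hk⟩ := hy r (by simp)
    obtain ⟨⟨z, hz⟩, h1, h2⟩ := ih
      (Y := fun i => gam {q : PrimeSpectrum R | r ∉ q.asIdeal} (Y i))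
      (d := fun i => gamMap _ (d i)) (fun i => (hY i).torsion _)
      (fun i y => Subtype.ext (hd i y))
      (fun i y hy => by
        obtain ⟨k, hk⟩ := exists_pow_smul_of_mem_gam y.2
        obtain ⟨z, hz, l, hl⟩ := exists_pow_smul_lift (fun i => (hY i).isGood r) hd hex i y
          (congrArg Subtype.val hy) hk
        exact ⟨⟨z, mem_gam_of_pow_smul hl⟩, Subtype.ext hz⟩)
      ⟨y, mem_gam_of_pow_smul hk⟩ (Subtype.ext hdy)
      (fun s hs => by
        obtain ⟨k, hk⟩ := hy s (by simp [hs])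
        exact ⟨k, Subtype.ext hk⟩)
    refine ⟨z, congrArg Subtype.val h1, fun s hs => ?_⟩
    obtain rfl | hs := List.mem_cons.1 hs
    · exact exists_pow_smul_of_mem_gam hz
    · obtain ⟨k, hk⟩ := h2 s hs
      exact ⟨k, congrArg Subtype.val hk⟩

theorem gam_exact [IsNoetherianRing R] (U : Set (PrimeSpectrum R)) (hY : ∀ i, IsHI R (Y i))
    (hd : ∀ i y, d (i + 1) (d i y) = 0) (hex : ∀ i y, d (i + 1) y = 0 → ∃ z, d i z = y)
    (i : ℤ) (y : Y (i + 1)) (hdy : d (i + 1) y = 0) (hy : y ∈ gam U (Y (i + 1))) :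
    ∃ z ∈ gam U (Y i), d i z = y := by
  obtain ⟨S, hS⟩ : (LinearMap.ker (LinearMap.toSpanSingleton R _ y)).FG :=
    IsNoetherian.noetherian _
  obtain ⟨z, hz, h⟩ := exists_pow_smul_list_lift S.toList hY hd hex i y hdy fun r hr => ⟨1, by
    have : r ∈ LinearMap.ker (LinearMap.toSpanSingleton R _ y) := by
      rw [← hS]; exact Submodule.subset_span (by simpa using hr)
    rw [pow_one]; exact this⟩
  refine ⟨z, fun q hq => ?_, hz⟩
  obtain ⟨s, hs, hsy⟩ := hy q hq
  obtain ⟨r, hr, hrq⟩ : ∃ r ∈ S, r ∉ q.asIdeal := by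
    by_contra! hall
    have : Submodule.span R (S : Set R) ≤ q.asIdeal := Submodule.span_le.2 hall
    rw [hS] at this
    exact hs (this hsy)
  obtain ⟨k, hk⟩ := h r (by simpa using hr)
  exact ⟨r ^ k, fun h => hrq (q.2.mem_of_pow_mem _ h), hk⟩

end Torsion

section Complexes

variable {R : Type u} [CommRing R]
variable {C T G G' I M : Type u} [AddCommGroup C] [Module R C] [AddCommGroup T] [Module R T]
  [AddCommGroup G] [Module R G] [AddCommGroup G'] [Module R G'] [AddCommGroup I] [Module R I]
  [AddCommGroup M] [Module R M]

theorem gamHomEquiv_spec [Module.Finite R M] (U : Set (PrimeSpectrum R))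
    (φ : gam U (M →ₗ[R] I)) : (gam U I).subtype ∘ₗ gamHomEquiv U φ = φ.1 :=
  congrArg Subtype.val ((LinearEquiv.ofInjective _ (compRight_subtype_injective U)).apply_symm_apply
    (LinearEquiv.ofEq _ _ (gam_hom_eq_range U).symm φ))

theorem IsICITerm.isHI (hC : Module.Finite R C) (h : IsICITerm R C T) : IsHI R T := by
  obtain h | ⟨I, _, _, hI, ⟨e⟩⟩ := h
  · exact ⟨ModuleCat.of R R, ModuleCat.of R T, inferInstanceAs (Module.Finite R R), h,
      ⟨(LinearMap.ringLmapEquivSelf R R T).symm⟩⟩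
  · exact ⟨ModuleCat.of R C, ModuleCat.of R I, hC, hI, ⟨e⟩⟩

theorem IsHI.hom [Module.Finite R M] (h : IsHI R T) : IsHI R (M →ₗ[R] T) := by
  obtain ⟨A, I, hA, hI, ⟨e⟩⟩ := h
  exact ⟨ModuleCat.of R (M ⊗[R] A), I, inferInstanceAs (Module.Finite R (M ⊗[R] A)), hI,
    ⟨e.congrRight ≪≫ₗ TensorProduct.lift.equiv (RingHom.id R) M A I⟩⟩

theorem IsHI.exists_retraction [IsNoetherianRing R] (h : IsHI R T) (U : Set (PrimeSpectrum R)) :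
    ∃ r : T →ₗ[R] gam U T, r ∘ₗ (gam U T).subtype = LinearMap.id := by
  obtain ⟨M, I, hM, hI, ⟨e⟩⟩ := h
  obtain ⟨r, hr⟩ := extend_of_injective_module (injective_gam U hI) (f := (gam U I).subtype)
    Subtype.val_injective LinearMap.id
  let E : gam U T ≃ₗ[R] (M →ₗ[R] gam U I) := gamEquiv U e ≪≫ₗ gamHomEquiv U
  refine ⟨E.symm.toLinearMap ∘ₗ r.compRight R (M := M) ∘ₗ e.toLinearMap, ?_⟩
  refine LinearMap.ext fun t => (E.symm_apply_eq).2 ?_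
  have h1 : (gam U I).subtype ∘ₗ E t = e t := gamHomEquiv_spec U (gamEquiv U e t)
  change r ∘ₗ e t = E t
  rw [← h1, ← LinearMap.comp_assoc, hr, LinearMap.id_comp]

theorem IsHI.exists_section [IsNoetherianRing R] (h : IsHI R T) (U : Set (PrimeSpectrum R)) :
    ∃ s : (T ⧸ gam U T) →ₗ[R] T, (gam U T).mkQ ∘ₗ s = LinearMap.id := by
  obtain ⟨r, hr⟩ := h.exists_retraction U
  obtain ⟨s, hs⟩ := factor_of_surjective (gam U T).mkQ_surjective
    (LinearMap.id - (gam U T).subtype ∘ₗ r) (fun x hx => by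
      have hx : x ∈ gam U T := (Submodule.Quotient.mk_eq_zero _).1 hx
      have := LinearMap.congr_fun hr ⟨x, hx⟩
      simp only [LinearMap.comp_apply, Submodule.subtype_apply] at this
      simp [this])
  refine ⟨s, ?_⟩
  rw [← LinearMap.cancel_right (gam U T).mkQ_surjective, LinearMap.comp_assoc, hs]
  ext x
  simp

theorem injective_quot_gam [IsNoetherianRing R] (hI : Module.Injective R I)
    (U : Set (PrimeSpectrum R)) : Module.Injective R (I ⧸ gam U I) := by
  obtain ⟨s, hs⟩ := IsHI.exists_section (IsICITerm.isHI (C := R) inferInstance (Or.inl hI)) U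
  exact injective_of_retract s _ hs hI

theorem map_gam (e : T ≃ₗ[R] G) (U : Set (PrimeSpectrum R)) :
    (gam U T).map e.toLinearMap = gam U G := by
  ext x
  refine ⟨?_, fun hx => ⟨e.symm x, map_mem_gam e.symm.toLinearMap hx, e.apply_symm_apply x⟩⟩
  rintro ⟨y, hy, rfl⟩
  exact map_mem_gam _ hy

theorem quot_gam_hom [IsNoetherianRing R] [Module.Finite R M] (hI : Module.Injective R I)
    (U : Set (PrimeSpectrum R)) :
    Nonempty (((M →ₗ[R] I) ⧸ gam U (M →ₗ[R] I)) ≃ₗ[R] (M →ₗ[R] I ⧸ gam U I)) := by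
  obtain ⟨s, hs⟩ := IsHI.exists_section (IsICITerm.isHI (C := R) inferInstance (Or.inl hI)) U
  have hsurj : Function.Surjective ((gam U I).mkQ.compRight R (M := M)) := fun φ =>
    ⟨s ∘ₗ φ, by rw [LinearMap.compRight_apply, ← LinearMap.comp_assoc, hs, LinearMap.id_comp]⟩
  have hker : gam U (M →ₗ[R] I) = LinearMap.ker ((gam U I).mkQ.compRight R (M := M)) := by
    rw [← gam_hom_eq_range]
    ext φ
    constructor
    · rintro ⟨ψ, rfl⟩
      ext m
      simp
    · intro h
      have h : (gam U I).mkQ ∘ₗ φ = 0 := h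
      exact ⟨φ.codRestrict _ fun m =>
        (Submodule.Quotient.mk_eq_zero _).1 (LinearMap.congr_fun h m), rfl⟩
  exact ⟨Submodule.quotEquivOfEq _ _ hker ≪≫ₗ LinearMap.quotKerEquivOfSurjective _ hsurj⟩

namespace CompleteICIRes

variable (X : CompleteICIRes R C)

theorem d_comp_d (i : ℤ) : X.d (i + 1) ∘ₗ X.d i = 0 := by
  rw [← LinearMap.range_le_ker_iff, X.exct]

theorem exists_of_d_eq_zero (i : ℤ) (y : X.X (i + 1)) (h : X.d (i + 1) y = 0) :
    ∃ z, X.d i z = y := by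
  have : y ∈ LinearMap.range (X.d i) := by rw [X.exct]; exact h
  exact this

theorem isICITerm (i : ℤ) : IsICITerm R C (X.X i) := by
  obtain h | h := lt_or_ge i 0
  · exact Or.inr (X.homCInjNeg i h)
  · exact Or.inl (X.injPos i h)

theorem isHI (hC : Module.Finite R C) (i : ℤ) : IsHI R (X.X i) := (X.isICITerm i).isHI hC

theorem gam_lift [IsNoetherianRing R] (hC : Module.Finite R C) (U : Set (PrimeSpectrum R)) (i : ℤ)
    (y : X.X (i + 1)) (hdy : X.d (i + 1) y = 0) (hy : y ∈ gam U (X.X (i + 1))) :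
    ∃ z ∈ gam U (X.X i), X.d i z = y :=
  gam_exact U (X.isHI hC) (fun i => LinearMap.congr_fun (X.d_comp_d i)) X.exists_of_d_eq_zero
    i y hdy hy

theorem homEx_gam [IsNoetherianRing R] {D : Type u} [AddCommGroup D] [Module R D]
    (hC : IsSemidualizing R C) (hD : IsDualizing R D) (U : Set (PrimeSpectrum R)) :
    HomEx (fun i => gamMap U (X.d i)) (C →ₗ[R] D) := by
  have := hC.finite
  have := hD.1.finite
  obtain ⟨n, hn⟩ := hD.2
  have hX : HomEx X.d (C →ₗ[R] D) :=
    homEx_hom_of_injDimLE hC X.d_comp_d X.isICITerm (fun J _ _ hJ => X.homExact J hJ) hn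
  have : Module.Finite R (C →ₗ[R] D) := inferInstance
  intro i g hg
  obtain ⟨h, hh, hdh⟩ := gam_exact (Y := fun i => (C →ₗ[R] D) →ₗ[R] X.X i)
    (d := fun i => (X.d i).compRight R) U (fun i => (X.isHI ‹_› i).hom)
    (fun i y => by
      simp only [LinearMap.compRight_apply]
      rw [← LinearMap.comp_assoc, X.d_comp_d, LinearMap.zero_comp]) hX i
    ((gam U _).subtype ∘ₗ g)
    (LinearMap.ext fun x => congrArg Subtype.val (LinearMap.congr_fun hg x))
    (by rw [← gam_hom_eq_range]; exact ⟨g, rfl⟩)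
  rw [← gam_hom_eq_range] at hh
  obtain ⟨k, rfl⟩ := hh
  exact ⟨k, LinearMap.ext fun x => Subtype.ext (LinearMap.congr_fun hdh x)⟩

/-- The subcomplex of elements vanishing in the localizations at the primes in `U`. -/
noncomputable def gamRes [IsNoetherianRing R] {D : Type u} [AddCommGroup D] [Module R D]
    (hC : IsSemidualizing R C) (hD : IsDualizing R D) (U : Set (PrimeSpectrum R)) :
    CompleteICIRes R C :=
  have := hC.finite
  have hdd : ∀ i, gamMap U (X.d (i + 1)) ∘ₗ gamMap U (X.d i) = 0 := fun i =>
    LinearMap.ext fun x => Subtype.ext (LinearMap.congr_fun (X.d_comp_d i) x.1)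
  have hneg : ∀ i : ℤ, i < 0 → ∃ (I : Type u) (_ : AddCommGroup I) (_ : Module R I),
      Module.Injective R I ∧ Nonempty (gam U (X.X i) ≃ₗ[R] (C →ₗ[R] I)) := by
    intro i hi
    obtain ⟨I, _, _, hI, ⟨e⟩⟩ := X.homCInjNeg i hi
    exact ⟨gam U I, inferInstance, inferInstance, injective_gam U hI,
      ⟨gamEquiv U e ≪≫ₗ gamHomEquiv U⟩⟩
  { X := fun i => gam U (X.X i)
    d := fun i => gamMap U (X.d i)
    exct := fun i => le_antisymm (LinearMap.range_le_ker_iff.2 (hdd i)) fun y hy => by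
      obtain ⟨z, hz, hzy⟩ := X.gam_lift ‹_› U i y (congrArg Subtype.val hy) y.2
      exact ⟨⟨z, hz⟩, Subtype.ext hzy⟩
    injPos := fun i hi => injective_gam U (X.injPos i hi)
    homCInjNeg := hneg
    homExact := fun J _ _ hJ => homEx_of_homEx_dualizing hC hD hdd (fun i => by
      obtain h | h := lt_or_ge i 0
      · exact Or.inr (hneg i h)
      · exact Or.inl (injective_gam U (X.injPos i h))) (X.homEx_gam hC hD U) hJ }

/-- The map induced by the differential modulo `gam U`. -/
def quotD (U : Set (PrimeSpectrum R)) (i : ℤ) :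
    (X.X i ⧸ gam U (X.X i)) →ₗ[R] (X.X (i + 1) ⧸ gam U (X.X (i + 1))) :=
  Submodule.mapQ _ _ (X.d i) fun _ hx => map_mem_gam _ hx

/-- The quotient complex modulo `gam U`. -/
noncomputable def quotRes [IsNoetherianRing R] {D : Type u} [AddCommGroup D] [Module R D]
    (hC : IsSemidualizing R C) (hD : IsDualizing R D) (U : Set (PrimeSpectrum R)) :
    CompleteICIRes R C :=
  have := hC.finite
  { X := fun i => X.X i ⧸ gam U (X.X i)
    d := X.quotD U
    exct := fun i => by
      refine le_antisymm ?_ ?_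
      · rintro _ ⟨y, rfl⟩
        obtain ⟨y, rfl⟩ := Submodule.mkQ_surjective _ y
        exact congrArg (gam U _).mkQ (LinearMap.congr_fun (X.d_comp_d i) y)
      · intro y hy
        obtain ⟨y, rfl⟩ := Submodule.mkQ_surjective _ y
        have hy : X.d (i + 1) y ∈ gam U _ := (Submodule.Quotient.mk_eq_zero _).1 hy
        obtain ⟨z, hz, hzy⟩ := X.gam_lift ‹_› U (i + 1) _ (LinearMap.congr_fun (X.d_comp_d _) y) hy
        obtain ⟨w, hw⟩ := X.exists_of_d_eq_zero i (y - z) (by rw [map_sub, hzy, sub_self])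
        refine ⟨(gam U _).mkQ w, ?_⟩
        change (gam U _).mkQ (X.d i w) = _
        rw [hw, map_sub, sub_eq_self]
        exact (Submodule.Quotient.mk_eq_zero _).2 hz
    injPos := fun i hi => injective_quot_gam (X.injPos i hi) U
    homCInjNeg := fun i hi => by
      obtain ⟨I, _, _, hI, ⟨e⟩⟩ := X.homCInjNeg i hi
      obtain ⟨e'⟩ := quot_gam_hom (M := C) hI U
      exact ⟨I ⧸ gam U I, inferInstance, inferInstance, injective_quot_gam hI U,
        ⟨Submodule.Quotient.equiv _ _ e (map_gam e U) ≪≫ₗ e'⟩⟩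
    homExact := fun J _ _ hJ i g hg => by
      obtain ⟨s, hs⟩ := IsHI.exists_section (X.isHI this (i + 1)) U
      have hmem : ∀ l, X.d (i + 1) (s (g l)) ∈ gam U _ := fun l => by
        have h1 : (gam U _).mkQ (s (g l)) = g l := LinearMap.congr_fun hs (g l)
        have h2 : X.quotD U (i + 1) (g l) = 0 := LinearMap.congr_fun hg l
        rw [← h1] at h2
        exact (Submodule.Quotient.mk_eq_zero _).1 h2
      obtain ⟨h, hh⟩ : ∃ h : (C →ₗ[R] J) →ₗ[R] gam U (X.X (i + 1)),
          gamMap U (X.d (i + 1)) ∘ₗ h = (X.d (i + 1) ∘ₗ s ∘ₗ g).codRestrict _ hmem :=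
        (X.gamRes hC hD U).homExact J hJ (i + 1) _ (LinearMap.ext fun l => Subtype.ext (LinearMap.congr_fun (X.d_comp_d (i + 1)) (s (g l))))
      obtain ⟨k, hk⟩ := X.homExact J hJ i (s ∘ₗ g - (gam U _).subtype ∘ₗ h)
        (LinearMap.ext fun l => by
          have := congrArg Subtype.val (LinearMap.congr_fun hh l)
          rw [LinearMap.comp_apply, LinearMap.sub_apply, map_sub, LinearMap.zero_apply,
            sub_eq_zero]
          exact this.symm)
      refine ⟨(gam U _).mkQ ∘ₗ k, LinearMap.ext fun l => ?_⟩
      have h1 : (gam U _).mkQ (s (g l)) = g l := LinearMap.congr_fun hs (g l)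
      have h2 : X.d i (k l) = s (g l) - h l := LinearMap.congr_fun hk l
      change (gam U _).mkQ (X.d i (k l)) = _
      rw [h2, map_sub, h1, sub_eq_self]
      exact (Submodule.Quotient.mk_eq_zero _).2 (h l).2 }

end CompleteICIRes

theorem cGorensteinInjective_iff : CGorensteinInjective R C G ↔ ∃ (X : CompleteICIRes R C)
    (a : G →ₗ[R] X.X (-1 + 1)), Function.Injective a ∧
      LinearMap.range a = LinearMap.range (X.d (-1)) := by
  constructor
  · rintro ⟨X, ⟨e⟩⟩
    refine ⟨X, (LinearMap.range (X.d (-1))).subtype ∘ₗ e.toLinearMap,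
      Subtype.val_injective.comp e.injective, ?_⟩
    rw [LinearMap.range_comp, LinearEquiv.range, Submodule.map_top, Submodule.range_subtype]
  · rintro ⟨X, a, ha, h⟩
    exact ⟨X, ⟨LinearEquiv.ofInjective a ha ≪≫ₗ LinearEquiv.ofEq _ _ h⟩⟩

theorem CGorensteinInjective.congr (h : CGorensteinInjective R C G) (e : G ≃ₗ[R] G') :
    CGorensteinInjective R C G' := by
  obtain ⟨X, ⟨e'⟩⟩ := h
  exact ⟨X, ⟨e.symm ≪≫ₗ e'⟩⟩

theorem CGorensteinInjective.isGood [IsNoetherianRing R] (hC : Module.Finite R C)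
    (h : CGorensteinInjective R C G) (x : R) : IsGood x G := by
  obtain ⟨X, ⟨e⟩⟩ := h
  exact ((X.isHI hC (-1)).isGood x).of_surjective
    (f := e.symm.toLinearMap ∘ₗ (X.d (-1)).rangeRestrict)
    (e.symm.surjective.comp (LinearMap.surjective_rangeRestrict _))

variable [IsNoetherianRing R] {D : Type u} [AddCommGroup D] [Module R D]

theorem CGorensteinInjective.torsion (hC : IsSemidualizing R C) (hD : IsDualizing R D)
    (h : CGorensteinInjective R C G) (U : Set (PrimeSpectrum R)) :
    CGorensteinInjective R C (gam U G) := by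
  obtain ⟨X, a, ha, har⟩ := cGorensteinInjective_iff.1 h
  refine cGorensteinInjective_iff.2 ⟨X.gamRes hC hD U, gamMap U a,
    fun x y hxy => Subtype.ext (ha (congrArg Subtype.val hxy)), le_antisymm ?_ ?_⟩
  · rintro _ ⟨g, rfl⟩
    have hg : a g.1 ∈ LinearMap.range (X.d (-1)) := har ▸ ⟨g.1, rfl⟩
    rw [X.exct] at hg
    obtain ⟨z, hz, hzg⟩ := X.gam_lift hC.finite U (-1) (a g.1) hg (map_mem_gam a g.2)
    exact ⟨⟨z, hz⟩, Subtype.ext hzg⟩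
  · rintro _ ⟨z, rfl⟩
    obtain ⟨g, hg⟩ : X.d (-1) z.1 ∈ LinearMap.range a := har ▸ ⟨z.1, rfl⟩
    exact ⟨⟨g, mem_gam_of_injective ha (hg ▸ map_mem_gam _ z.2)⟩, Subtype.ext hg⟩

theorem CGorensteinInjective.quot (hC : IsSemidualizing R C) (hD : IsDualizing R D)
    (h : CGorensteinInjective R C G) (U : Set (PrimeSpectrum R)) :
    CGorensteinInjective R C (G ⧸ gam U G) := by
  obtain ⟨X, a, ha, har⟩ := cGorensteinInjective_iff.1 h
  have hinj : Function.Injective (Submodule.mapQ (gam U G) (gam U (X.X (-1 + 1))) a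
      fun _ hx => map_mem_gam a hx) := by
    rw [← LinearMap.ker_eq_bot, Submodule.eq_bot_iff]
    intro x hx
    obtain ⟨x, rfl⟩ := Submodule.mkQ_surjective _ x
    have hx : a x ∈ gam U _ := (Submodule.Quotient.mk_eq_zero _).1 hx
    exact (Submodule.Quotient.mk_eq_zero _).2 (mem_gam_of_injective ha hx)
  refine cGorensteinInjective_iff.2 ⟨X.quotRes hC hD U, Submodule.mapQ _ _ a fun _ hx =>
    map_mem_gam a hx, hinj, le_antisymm ?_ ?_⟩
  · rintro _ ⟨g, rfl⟩
    obtain ⟨g, rfl⟩ := Submodule.mkQ_surjective _ g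
    obtain ⟨z, hz⟩ : a g ∈ LinearMap.range (X.d (-1)) := har ▸ ⟨g, rfl⟩
    exact ⟨(gam U _).mkQ z, congrArg (gam U _).mkQ hz⟩
  · rintro _ ⟨z, rfl⟩
    obtain ⟨z, rfl⟩ := Submodule.mkQ_surjective _ z
    obtain ⟨g, hg⟩ : X.d (-1) z ∈ LinearMap.range a := har ▸ ⟨z, rfl⟩
    exact ⟨(gam U _).mkQ g, congrArg (gam U _).mkQ hg⟩

end Complexes

section Decomposition

variable {R : Type u} [CommRing R] {C G N : Type u} [AddCommGroup C] [Module R C]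
  [AddCommGroup G] [Module R G] [AddCommGroup N] [Module R N]

theorem mem_torsionSubmodule {a : Ideal R} {x : N} :
    x ∈ torsionSubmodule R a N ↔ ∃ m : ℕ, ∀ r ∈ a ^ m, r • x = 0 := by
  rw [torsionSubmodule, Submodule.mem_iSup_of_directed]
  · simp [Submodule.mem_torsionBySet_iff]
  · refine Monotone.directed_le fun m n hmn => ?_
    exact Submodule.torsionBySet_le_torsionBySet_of_subset (Ideal.pow_le_pow_right hmn)

/-- The localization of `G` at `p`. -/
abbrev LocMod (p : PrimeSpectrum R) (G : Type u) [AddCommGroup G] [Module R G] : Type u :=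
  LocalizedModule p.asIdeal.primeCompl G

/-- The localization map at `p`. -/
noncomputable abbrev loc (p : PrimeSpectrum R) (G : Type u) [AddCommGroup G] [Module R G] :
    G →ₗ[R] LocMod p G :=
  LocalizedModule.mkLinearMap p.asIdeal.primeCompl G

theorem loc_eq_zero_iff {p : PrimeSpectrum R} {x : G} :
    loc p G x = 0 ↔ ∃ s, s ∉ p.asIdeal ∧ s • x = 0 := by
  rw [IsLocalizedModule.eq_zero_iff p.asIdeal.primeCompl]
  exact ⟨fun ⟨s, hs⟩ => ⟨s, s.2, hs⟩, fun ⟨s, hs, hsx⟩ => ⟨⟨s, hs⟩, hsx⟩⟩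

theorem smul_bijective_locMod (p : PrimeSpectrum R) {s : R} (hs : s ∉ p.asIdeal) :
    Function.Bijective (fun y : LocMod p G => s • y) :=
  (Module.End.isUnit_iff _).1 (IsLocalizedModule.map_units (loc p G)
    (⟨s, hs⟩ : p.asIdeal.primeCompl))

theorem propT_torsionSubmodule_locMod (p : PrimeSpectrum R) :
    PropT R p.asIdeal (torsionSubmodule R p.asIdeal (LocMod p G)) := by
  refine ⟨fun s hs => ⟨fun x y hxy => Subtype.ext ((smul_bijective_locMod p hs).1
    (congrArg Subtype.val hxy)), fun y => ?_⟩, fun x => ?_⟩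
  · obtain ⟨z, hz⟩ := (smul_bijective_locMod p hs).2 y.1
    have hz : s • z = y.1 := hz
    obtain ⟨m, hm⟩ := mem_torsionSubmodule.1 y.2
    refine ⟨⟨z, mem_torsionSubmodule.2 ⟨m, fun r hr => (smul_bijective_locMod p hs).1 ?_⟩⟩,
      Subtype.ext hz⟩
    change s • r • z = s • (0 : LocMod p G)
    rw [smul_comm, hz, hm r hr, smul_zero]
  · obtain ⟨m, hm⟩ := mem_torsionSubmodule.1 x.2
    exact ⟨m + 1, m.succ_pos, fun a ha => Subtype.ext (hm a (Ideal.pow_le_pow_right m.le_succ ha))⟩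

/-- The primes that do not contain `p`. -/
def notAbove (p : PrimeSpectrum R) : Set (PrimeSpectrum R) := {q | ¬ p.asIdeal ≤ q.asIdeal}

/-- The primes of height less than `k`. -/
def heightLT (R : Type u) [CommRing R] (k : ℕ) : Set (PrimeSpectrum R) :=
  {q | Order.height q < k}

theorem heightLT_mono {a b : ℕ} (h : a ≤ b) : heightLT R a ⊆ heightLT R b := fun _ hq =>
  lt_of_lt_of_le (b := (a : ℕ∞)) hq (by exact_mod_cast h)

theorem exists_smul_eq_zero_of_lt {k : ℕ} {x : G} (hx : x ∈ gam (heightLT R k) G)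
    {p q : PrimeSpectrum R} (hp : Order.height p = k) (hqp : q < p) :
    ∃ s, s ∉ q.asIdeal ∧ s • x = 0 := by
  refine hx q (?_ : Order.height q < k)
  rw [← hp]
  exact Order.height_strictMono hqp
    ((Order.height_mono hqp.le).trans_lt (hp ▸ ENat.natCast_lt_top k))

theorem heightLT_subset_notAbove {k : ℕ} {p : PrimeSpectrum R} (hp : Order.height p = k) :
    heightLT R k ⊆ notAbove p := fun q (hq : Order.height q < k) hpq =>
  (hp ▸ hq).not_ge (Order.height_mono (show p ≤ q from hpq))

theorem mem_notAbove_of_ne {k : ℕ} {p q : PrimeSpectrum R} (hp : Order.height p = k)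
    (hq : Order.height q = k) (hpq : p ≠ q) : q ∈ notAbove p := fun h => by
  have := Order.height_strictMono (lt_of_le_of_ne (show p ≤ q from h) hpq)
    (hp ▸ ENat.natCast_lt_top k)
  exact this.ne (hp.trans hq.symm)

theorem gam_heightLT_zero : gam (heightLT R 0) G = ⊤ :=
  eq_top_iff.2 fun _ _ _ hq => absurd hq (by simp [heightLT])

theorem gam_heightLT_of_krullDim {d : ℕ} (hd : ringKrullDim R = ((d : ℕ∞) : WithBot ℕ∞)) :
    gam (heightLT R (d + 1)) G = ⊥ := by
  refine (Submodule.eq_bot_iff _).2 fun x hx => ?_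
  by_contra hx0
  obtain ⟨m, hm, hle⟩ := Ideal.exists_le_maximal (LinearMap.ker (LinearMap.toSpanSingleton R G x))
    ((Ideal.ne_top_iff_one _).2 fun h => hx0 (by simpa using h))
  obtain ⟨s, hs, hsx⟩ := hx ⟨m, hm.isPrime⟩ (by
    have h := Order.height_le_krullDim (⟨m, hm.isPrime⟩ : PrimeSpectrum R)
    have h2 : Order.krullDim (PrimeSpectrum R) = ((d : ℕ∞) : WithBot ℕ∞) := hd
    rw [h2] at h
    refine (WithBot.coe_le_coe.1 h).trans_lt ?_
    exact_mod_cast d.lt_succ_self)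
  exact hs (hle hsx)

variable [IsNoetherianRing R]

theorem mem_torsionSubmodule_of_le_radical {a : Ideal R} {x : N}
    (h : a ≤ Ideal.radical (LinearMap.ker (LinearMap.toSpanSingleton R N x))) :
    x ∈ torsionSubmodule R a N := by
  obtain ⟨m, hm⟩ := Ideal.exists_pow_le_of_le_radical_of_fg h (IsNoetherian.noetherian a)
  exact mem_torsionSubmodule.2 ⟨m, fun r hr => hm hr⟩

theorem range_loc_gam {p : PrimeSpectrum R} (hgood : ∀ r : R, IsGood r (gam (notAbove p) G)) :
    LinearMap.range (loc p G ∘ₗ (gam (notAbove p) G).subtype) =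
      torsionSubmodule R p.asIdeal (LocMod p G) := by
  refine le_antisymm ?_ fun y hy => ?_
  · rintro _ ⟨x, rfl⟩
    exact mem_torsionSubmodule_of_le_radical
      (le_radical_annihilator_of_mem_gam (map_mem_gam (loc p G) x.2))
  · obtain ⟨m, hm⟩ := mem_torsionSubmodule.1 hy
    obtain ⟨⟨x, s⟩, hx⟩ := IsLocalizedModule.surj p.asIdeal.primeCompl (loc p G) y
    have hx : s.1 • y = loc p G x := hx
    obtain ⟨t, ht, htx⟩ := exists_smul_eq_zero_of_fg (U := {p})
      (P := Submodule.map (LinearMap.toSpanSingleton R G x) (p.asIdeal ^ m))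
      (Submodule.FG.map _ (IsNoetherian.noetherian _)) (by
        rintro _ ⟨a, ha, rfl⟩ q rfl
        refine loc_eq_zero_iff.1 ?_
        rw [LinearMap.toSpanSingleton_apply, map_smul, ← hx, smul_comm, hm a ha, smul_zero])
      (Set.mem_singleton p)
    have hw : t • x ∈ gam (notAbove p) G := fun q hq => by
      obtain ⟨a, ha, haq⟩ := Set.not_subset.1 hq
      refine ⟨a ^ m, fun h => haq (q.2.mem_of_pow_mem _ h), ?_⟩
      rw [smul_comm]
      exact htx _ ⟨a ^ m, Ideal.pow_mem_pow ha m, rfl⟩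
    obtain ⟨v, k, hv⟩ := hgood (t * s) ⟨t • x, hw⟩ 1
    refine ⟨v, (smul_bijective_locMod p (s := (t * s) ^ (k + 1)) fun h =>
      (p.2.mem_or_mem (p.2.mem_of_pow_mem _ h)).elim ht s.2).1 ?_⟩
    have h1 := congrArg (fun z => loc p G z.1) hv
    simp only [Submodule.coe_smul, map_smul] at h1
    change (t * s.1) ^ (k + 1) • loc p G v.1 = (t * s.1) ^ (k + 1) • y
    rw [h1, ← hx, pow_succ, mul_smul _ _ y, mul_smul t]

theorem torsionSubmodule_locMod_equiv {p : PrimeSpectrum R}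
    (hgood : ∀ r : R, IsGood r (gam (notAbove p) G)) :
    Nonempty ((gam (notAbove p) G ⧸ gam {p} (gam (notAbove p) G)) ≃ₗ[R]
      torsionSubmodule R p.asIdeal (LocMod p G)) := by
  have hker : gam {p} (gam (notAbove p) G) =
      LinearMap.ker (loc p G ∘ₗ (gam (notAbove p) G).subtype) := by
    ext x
    rw [LinearMap.mem_ker, LinearMap.comp_apply, loc_eq_zero_iff]
    refine ⟨fun h => ?_, ?_⟩
    · obtain ⟨s, hs, hsx⟩ := h p rfl
      exact ⟨s, hs, congrArg Subtype.val hsx⟩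
    · rintro ⟨s, hs, hsx⟩ q rfl
      exact ⟨s, hs, Subtype.ext hsx⟩
  exact ⟨Submodule.quotEquivOfEq _ _ hker ≪≫ₗ LinearMap.quotKerEquivRange _ ≪≫ₗ
    LinearEquiv.ofEq _ _ (range_loc_gam hgood)⟩

theorem loc_mem_torsionSubmodule {k : ℕ} {x : G} (hx : x ∈ gam (heightLT R k) G)
    {p : PrimeSpectrum R} (hp : Order.height p = k) :
    loc p G x ∈ torsionSubmodule R p.asIdeal (LocMod p G) := by
  refine mem_torsionSubmodule_of_le_radical fun a ha => ?_
  by_contra hcon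
  have hdis : Disjoint (LinearMap.ker (LinearMap.toSpanSingleton R G x) : Set R)
      (Submonoid.powers a ⊔ p.asIdeal.primeCompl : Submonoid R) := by
    rw [Set.disjoint_left]
    intro r hr hrS
    obtain ⟨_, ⟨n, rfl⟩, s, hs, rfl⟩ := Submonoid.mem_sup.1 hrS
    have hr : (a ^ n * s) • x = 0 := hr
    refine hcon ⟨n, ?_⟩
    change a ^ n • loc p G x = 0
    rw [← map_smul, loc_eq_zero_iff]
    exact ⟨s, hs, by rw [← mul_smul, mul_comm, hr]⟩
  obtain ⟨q, hq, hle, hdq⟩ := Ideal.exists_le_prime_disjoint _ _ hdis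
  have hqp : q ≤ p.asIdeal := fun r hr => by
    by_contra h
    exact Set.disjoint_left.1 hdq hr (Submonoid.mem_sup_right (show r ∈ p.asIdeal.primeCompl from h))
  have haq : a ∉ q := fun h =>
    Set.disjoint_left.1 hdq h (Submonoid.mem_sup_left (Submonoid.mem_powers a))
  obtain ⟨s, hs, hsx⟩ := exists_smul_eq_zero_of_lt hx (q := ⟨q, hq⟩) hp
    (lt_of_le_not_ge hqp fun h => haq (h ha))
  exact hs (hle hsx)

theorem finite_loc_ne_zero {k : ℕ} {x : G} (hx : x ∈ gam (heightLT R k) G) :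
    {p : {p : PrimeSpectrum R // Order.height p = (k : ℕ∞)} | loc p.1 G x ≠ 0}.Finite := by
  refine Set.Finite.of_finite_image ((Ideal.finite_minimalPrimes_of_isNoetherianRing R
    (LinearMap.ker (LinearMap.toSpanSingleton R G x))).subset ?_)
    (f := fun p => p.1.asIdeal) fun p _ q _ h => Subtype.ext (PrimeSpectrum.ext h)
  rintro _ ⟨p, hp, rfl⟩
  refine ⟨⟨p.1.2, fun s hs => ?_⟩, fun q ⟨hq, hle⟩ hqp => ?_⟩
  · by_contra h
    exact hp (loc_eq_zero_iff.2 ⟨s, h, hs⟩)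
  · by_contra h
    obtain ⟨s, hs, hsx⟩ := exists_smul_eq_zero_of_lt hx (q := ⟨q, hq⟩) p.2
      (lt_of_le_not_ge hqp h)
    exact hs (hle hsx)

theorem filtration_quot_equiv (hgood : ∀ (p : PrimeSpectrum R) (r : R),
    IsGood r (gam (notAbove p) G)) (k : ℕ) :
    Nonempty ((gam (heightLT R k) G ⧸
        Submodule.comap (gam (heightLT R k) G).subtype (gam (heightLT R (k + 1)) G)) ≃ₗ[R]
      ⨁ p : {p : PrimeSpectrum R // Order.height p = (k : ℕ∞)},
        torsionSubmodule R p.1.asIdeal (LocMod p.1 G)) := by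
  classical
  let ι := {p : PrimeSpectrum R // Order.height p = (k : ℕ∞)}
  let S : ι → Type u := fun p => torsionSubmodule R p.1.asIdeal (LocMod p.1 G)
  let Θ : gam (heightLT R k) G →ₗ[R] ∀ p : ι, LocMod p.1 G :=
    LinearMap.pi fun p => loc p.1 G ∘ₗ (gam (heightLT R k) G).subtype
  let Ψ : (⨁ p, S p) →ₗ[R] ∀ p : ι, LocMod p.1 G :=
    LinearMap.pi fun p => (torsionSubmodule R p.1.asIdeal (LocMod p.1 G)).subtype ∘ₗ
      DirectSum.component R ι S p
  have hΨ : Function.Injective Ψ := fun y z h =>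
    DFinsupp.ext fun p => Subtype.ext (congrFun h p)
  have hker : Submodule.comap (gam (heightLT R k) G).subtype (gam (heightLT R (k + 1)) G) =
      LinearMap.ker Θ := by
    ext x
    constructor
    · refine fun h => funext fun p => loc_eq_zero_iff.2 (h p.1 ?_)
      change Order.height p.1 < ((k + 1 : ℕ) : ℕ∞)
      rw [p.2]
      exact_mod_cast k.lt_succ_self
    · intro h q hq
      have hq : Order.height q < ((k + 1 : ℕ) : ℕ∞) := hq
      obtain hlt | heq := (Order.lt_add_one_iff_of_not_isMax (by simp)).1
        (show Order.height q < (k : ℕ∞) + 1 by exact_mod_cast hq) |>.lt_or_eq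
      · exact x.2 q hlt
      · exact loc_eq_zero_iff.1 (congrFun h (⟨q, heq⟩ : ι))
  have hrange : LinearMap.range Θ = LinearMap.range Ψ := by
    apply le_antisymm
    · rintro _ ⟨x, rfl⟩
      have hfin := finite_loc_ne_zero x.2
      let t : ⨁ p, S p := DirectSum.mk S hfin.toFinset fun p =>
        ⟨loc p.1.1 G x, loc_mem_torsionSubmodule x.2 p.1.2⟩
      refine ⟨t, funext fun p => ?_⟩
      change (t p).1 = loc p.1 G x
      by_cases hp : p ∈ hfin.toFinset
      · rw [show t p = _ from DirectSum.mk_apply_of_mem hp]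
      · rw [show t p = 0 from DirectSum.mk_apply_of_notMem hp]
        by_contra h
        exact hp (hfin.mem_toFinset.2 (Ne.symm h))
    · rintro _ ⟨y, rfl⟩
      induction y using DirectSum.induction_on with
      | zero => rw [map_zero]; exact zero_mem _
      | add y z hy hz => rw [map_add]; exact add_mem hy hz
      | of p y =>
        obtain ⟨v, hv⟩ : y.1 ∈ LinearMap.range (loc p.1 G ∘ₗ (gam (notAbove p.1) G).subtype) := by
          rw [range_loc_gam (hgood p.1)]
          exact y.2
        refine ⟨⟨v, gam_anti (heightLT_subset_notAbove p.2) v.2⟩, funext fun q => ?_⟩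
        change loc q.1 G v = (DirectSum.of S p y q : S q).1
        by_cases hpq : p = q
        · subst hpq
          rw [DirectSum.of_eq_same]
          exact hv
        · rw [DirectSum.of_eq_of_ne _ _ _ (Ne.symm hpq)]
          exact loc_eq_zero_iff.2 (v.2 q.1 (mem_notAbove_of_ne p.2 q.2
            fun h => hpq (Subtype.ext h)))
  exact ⟨Submodule.quotEquivOfEq _ _ hker ≪≫ₗ LinearMap.quotKerEquivRange Θ ≪≫ₗ
    LinearEquiv.ofEq _ _ hrange ≪≫ₗ (LinearEquiv.ofInjective Ψ hΨ).symm⟩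

end Decomposition

end Auxiliary

/-- Over a `d`-dimensional Cohen-Macaulay noetherian ring `R` with dualizing
module `D` and semidualizing module `C`, every `C`-Gorenstein injective module `G` has a
filtration `0 = G_{d+1} ⊆ G_d ⊆ ⋯ ⊆ G_1 ⊆ G_0 = G` by `C`-Gorenstein injective submodules whose
subsequent quotients are `C`-Gorenstein injective and decompose as
`G_k/G_{k+1} ≅ ⊕_{ht p = k} G_(p)` with `G_(p) ≅ Γ_p(G_p)`, each `G_(p)` being `C`-Gorenstein
injective and satisfying `t(p)`. -/
theorem statement17 (R : Type u) [CommRing R] [IsNoetherianRing R]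
    (hCM : IsCohenMacaulayRing R) (d : ℕ) (hd : ringKrullDim R = ((d : ℕ∞) : WithBot ℕ∞))
    (D : Type u) [AddCommGroup D] [Module R D] (hD : IsDualizing R D)
    (C : Type u) [AddCommGroup C] [Module R C] (hC : IsSemidualizing R C)
    (G : Type u) [AddCommGroup G] [Module R G] (hG : CGorensteinInjective R C G) :
    -- each G_(p) = Γ_p(G_p) is C-Gorenstein injective and satisfies t(p)
    (∀ p : PrimeSpectrum R,
      CGorensteinInjective R C
        ↥(torsionSubmodule R p.asIdeal (LocalizedModule p.asIdeal.primeCompl G)) ∧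
      PropT R p.asIdeal
        ↥(torsionSubmodule R p.asIdeal (LocalizedModule p.asIdeal.primeCompl G))) ∧
    -- the filtration
    ∃ Gsub : Fin (d + 2) → Submodule R G,
      Antitone Gsub ∧ Gsub 0 = ⊤ ∧ Gsub (Fin.last (d + 1)) = ⊥ ∧
      (∀ k : Fin (d + 2), CGorensteinInjective R C ↥(Gsub k)) ∧
      (∀ k : Fin (d + 1),
        CGorensteinInjective R C
          (↥(Gsub k.castSucc) ⧸
            Submodule.comap (Gsub k.castSucc).subtype (Gsub k.succ)) ∧
        Nonempty ((↥(Gsub k.castSucc) ⧸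
            Submodule.comap (Gsub k.castSucc).subtype (Gsub k.succ)) ≃ₗ[R]
          (⨁ p : {p : PrimeSpectrum R // Order.height p = ((k : ℕ) : ℕ∞)},
            ↥(torsionSubmodule R p.1.asIdeal
                (LocalizedModule p.1.asIdeal.primeCompl G))))) := by
  have hgood : ∀ (p : PrimeSpectrum R) (r : R), IsGood r (gam (notAbove p) G) := fun p =>
    (hG.torsion hC hD (notAbove p)).isGood hC.finite
  refine ⟨fun p => ⟨?_, propT_torsionSubmodule_locMod p⟩, fun k => gam (heightLT R k) G,
    fun _ _ hab => gam_anti (heightLT_mono hab),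
    gam_heightLT_zero, gam_heightLT_of_krullDim hd, fun k => hG.torsion hC hD _,
    fun k => ⟨?_, filtration_quot_equiv hgood k⟩⟩
  · obtain ⟨e⟩ := torsionSubmodule_locMod_equiv (hgood p)
    exact ((hG.torsion hC hD (notAbove p)).quot hC hD {p}).congr e
  · have h : gam (heightLT R (k + 1)) (gam (heightLT R k) G) =
        Submodule.comap (gam (heightLT R k) G).subtype (gam (heightLT R (k + 1)) G) :=
      Submodule.ext fun x => ⟨fun hx => map_mem_gam (gam (heightLT R k) G).subtype hx,
        fun hx => mem_gam_of_injective Subtype.val_injective hx⟩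
    exact ((hG.torsion hC hD (heightLT R k)).quot hC hD (heightLT R (k + 1))).congr
      (Submodule.quotEquivOfEq _ _ h)
end

section
/- Let R be a Cohen-Macaulay commutative noetherian ring with a dualizing module D, let C be a semidualizing R-module, and let p be a minimal prime of R such that C_p ≅ D_p. Then every R_p-module T is C-Gorenstein injective when viewed as an R-module. -/
/-!
Common definitions: property t(p), injective hulls, (C-)Gorenstein injective modules,
(C-)Gorenstein injective / injective / flat dimensions, small support, torsion functor,
Tor and Ext modules, semidualizing and dualizing modules, depth, Cohen-Macaulay rings,
Serre's condition (S₁), Gorenstein local rings, minimal injective resolutions.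
-/

universe u

open CategoryTheory Limits DirectSum

namespace ArtinianLocal
open IsLocalRing

section
variable {A : Type u} [CommRing A] [IsLocalRing A]

theorem exists_smul_mem_socle [IsArtinianRing A] {M : Type u} [AddCommGroup M] [Module A M]
    {x : M} (hx : x ≠ 0) : ∃ a : A, a • x ≠ 0 ∧ ∀ b ∈ maximalIdeal A, b • a • x = 0 := by
  have key : ∀ n : ℕ, (∀ b ∈ maximalIdeal A ^ n, b • x = 0) →
      ∃ a : A, a • x ≠ 0 ∧ ∀ b ∈ maximalIdeal A, b • a • x = 0 := by
    intro n
    induction n with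
    | zero => intro h; exact absurd (by simpa using h 1 (by simp)) hx
    | succ n ih =>
      intro h
      by_cases h' : ∀ b ∈ maximalIdeal A ^ n, b • x = 0
      · exact ih h'
      · push Not at h'
        obtain ⟨a, ha, hax⟩ := h'
        refine ⟨a, hax, fun b hb => ?_⟩
        rw [smul_smul]
        exact h _ (by rw [pow_succ']; exact Ideal.mul_mem_mul hb ha)
  obtain ⟨n, hn⟩ := IsArtinianRing.isNilpotent_jacobson_bot (R := A)
  rw [jacobson_eq_maximalIdeal _ bot_ne_top] at hn
  refine key n fun b hb => ?_
  rw [hn] at hb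
  simp [(Submodule.mem_bot A).1 hb]

theorem exists_linearMap_apply_eq_of_socle {M K : Type u} [AddCommGroup M] [Module A M]
    [AddCommGroup K] [Module A K] [Module.Injective A K] {s : M} (hs : s ≠ 0)
    (hms : ∀ b ∈ maximalIdeal A, b • s = 0) {n : K} (hn : ∀ b ∈ maximalIdeal A, b • n = 0) :
    ∃ h : M →ₗ[A] K, h s = n := by
  let f : (A ⧸ maximalIdeal A) →ₗ[A] M :=
    (maximalIdeal A).liftQ (LinearMap.toSpanSingleton A M s) (fun b hb => by simpa using hms b hb)
  let g : (A ⧸ maximalIdeal A) →ₗ[A] K :=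
    (maximalIdeal A).liftQ (LinearMap.toSpanSingleton A K n) (fun b hb => by simpa using hn b hb)
  have hf : Function.Injective f := by
    rw [← LinearMap.ker_eq_bot]
    refine Submodule.ker_liftQ_eq_bot _ _ _ fun b hb => ?_
    by_contra hb'
    have hu : IsUnit b := by simpa using hb'
    have : b • s = 0 := by simpa using hb
    exact hs ((hu.smul_eq_zero).1 this)
  obtain ⟨h, hh⟩ := Module.Injective.extension_property A K _ _ f hf g
  refine ⟨h, ?_⟩
  have hf1 : f (Submodule.Quotient.mk (1 : A)) = s := by
    simp only [f, Submodule.liftQ_apply, LinearMap.toSpanSingleton_apply_one]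
  have hg1 : g (Submodule.Quotient.mk (1 : A)) = n := by
    simp only [g, Submodule.liftQ_apply, LinearMap.toSpanSingleton_apply_one]
  rw [← hf1, ← hg1, ← hh, LinearMap.comp_apply]

theorem baer_of_extend_maximalIdeal [IsArtinianRing A] {M : Type u} [AddCommGroup M] [Module A M]
    (H : ∀ g : maximalIdeal A →ₗ[A] M, ∃ i : M, ∀ a, g a = (a : A) • i) : Module.Baer A M := by
  intro I
  induction I using IsNoetherian.induction (R := A) (M := A) with
  | hgt I ih =>
  intro g
  by_cases hI : I = ⊤
  · subst hI
    exact ⟨g ∘ₗ (Submodule.topEquiv (R := A) (M := A)).symm.toLinearMap, fun x hx => rfl⟩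
  have h1 : (Submodule.Quotient.mk (1 : A) : A ⧸ I) ≠ 0 := by
    rw [Ne, Submodule.Quotient.mk_eq_zero]
    exact fun h => hI ((Ideal.eq_top_iff_one I).2 h)
  obtain ⟨a, ha, hma⟩ := exists_smul_mem_socle (A := A) h1
  simp only [← Submodule.Quotient.mk_smul, Ne, Submodule.Quotient.mk_eq_zero, smul_eq_mul,
    mul_one] at ha hma
  obtain ⟨i, hi⟩ := H (g ∘ₗ ((LinearMap.toSpanSingleton A A a) ∘ₗ
    (maximalIdeal A).subtype).codRestrict I (fun b => by simpa using hma b b.2))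
  let J : Ideal A := I ⊔ Submodule.span A {a}
  have haJ : a ∈ J := Submodule.mem_sup_right (Submodule.mem_span_singleton_self a)
  have hIJ : I < J := lt_of_le_of_ne le_sup_left (fun h => ha (h ▸ haJ))
  let s : (I × A) →ₗ[A] J := LinearMap.coprod (Submodule.inclusion le_sup_left)
    (LinearMap.toSpanSingleton A J ⟨a, haJ⟩)
  let t : (I × A) →ₗ[A] M := LinearMap.coprod g (LinearMap.toSpanSingleton A M i)
  have hs : Function.Surjective s := by
    rintro ⟨x, hx⟩
    obtain ⟨y, hy, z, hz, rfl⟩ := Submodule.mem_sup.1 hx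
    obtain ⟨r, rfl⟩ := Submodule.mem_span_singleton.1 hz
    exact ⟨(⟨y, hy⟩, r), by ext; simp [s]⟩
  have hst : LinearMap.ker s ≤ LinearMap.ker t := by
    rintro ⟨y, r⟩ h
    have h0 : (y : A) + r * a = 0 := by simpa [s] using congrArg Subtype.val (LinearMap.mem_ker.1 h)
    have hra : r * a ∈ I := by
      rw [show r * a = -(y : A) by linear_combination h0]
      exact I.neg_mem y.2
    have hr : r ∈ maximalIdeal A := by
      by_contra hr
      have hu : IsUnit r := by simpa using hr
      exact ha ((Ideal.unit_mul_mem_iff_mem I hu).1 hra)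
    have h2 := hi ⟨r, hr⟩
    have h3 : y = -(⟨r * a, hra⟩ : I) := Subtype.ext (by simp; linear_combination h0)
    have h4 : g ⟨r * a, hra⟩ = r • i := h2
    simp [t, h3, h4]
  let f : J →ₗ[A] M := (LinearMap.ker s).liftQ t hst ∘ₗ
    (s.quotKerEquivOfSurjective hs).symm.toLinearMap
  have hf : ∀ q, f (s q) = t q := by
    intro q
    have : (s.quotKerEquivOfSurjective hs).symm (s q) = Submodule.Quotient.mk q := by
      rw [LinearEquiv.symm_apply_eq]; rfl
    simp [f, this]
  obtain ⟨g', hg'⟩ := ih J hIJ f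
  refine ⟨g', fun x hx => ?_⟩
  rw [hg' x (hIJ.le hx)]
  have := hf (⟨x, hx⟩, 0)
  simp only [s, t, LinearMap.coprod_apply, map_zero, add_zero] at this
  exact this

theorem injective_of_exact [IsArtinianRing A] {M I N : Type u} [AddCommGroup M] [Module A M]
    [AddCommGroup I] [Module A I] [AddCommGroup N] [Module A N]
    [Module.Injective A I] [Module.Injective A N] (ι : M →ₗ[A] I) (π : I →ₗ[A] N)
    (hι : Function.Injective ι) (hπ : Function.Surjective π) (hex : Function.Exact ι π) :
    Module.Injective A M := by
  refine (baer_of_extend_maximalIdeal fun g => ?_).injective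
  obtain ⟨h, hh⟩ := Module.Injective.extension_property A I _ _ (maximalIdeal A).subtype
    Subtype.val_injective (ι ∘ₗ g)
  have hg : ∀ a : maximalIdeal A, (a : A) • h 1 = ι (g a) := fun a => by
    rw [← map_smul]; simpa using LinearMap.congr_fun hh a
  obtain ⟨s, hs, hms⟩ := exists_smul_mem_socle (A := A) (one_ne_zero (α := A))
  obtain ⟨k, hk⟩ := exists_linearMap_apply_eq_of_socle (K := N) hs hms (n := π (h 1))
    (fun b hb => by rw [← map_smul, hg ⟨b, hb⟩, hex.apply_apply_eq_zero])
  obtain ⟨j, hj⟩ := hπ (k 1)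
  obtain ⟨i, hi⟩ := (hex (h 1 - s • j)).1 (by
    rw [map_sub, ← hk, map_smul, map_smul, hj, sub_self])
  refine ⟨i, fun a => hι ?_⟩
  rw [map_smul, hi, ← hg, smul_sub]
  have : (a : A) • s • (1 : A) = 0 := hms a a.2
  have h0 : (a : A) * s = 0 := by simpa using this
  rw [smul_smul, h0, zero_smul, sub_zero]

end

theorem finsupp_support_subset {A : Type u} [CommRing A] {M N ι : Type u} [AddCommGroup M]
    [Module A M] [Module.Finite A M] [AddCommGroup N] [Module A N] (f : M →ₗ[A] ι →₀ N) :
    ∃ s : Finset ι, ∀ x, ∀ i ∉ s, f x i = 0 := by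
  classical
  obtain ⟨t, ht⟩ := Module.Finite.fg_top (R := A) (M := M)
  refine ⟨t.biUnion fun x => (f x).support, fun x i hi => ?_⟩
  have hx : x ∈ Submodule.span A (t : Set M) := ht ▸ Submodule.mem_top
  have : Submodule.span A (t : Set M) ≤ LinearMap.ker (Finsupp.lapply i ∘ₗ f) := by
    rw [Submodule.span_le]
    intro y hy
    by_contra h
    exact hi (Finset.mem_biUnion.2 ⟨y, hy, by simpa using h⟩)
  exact this hx

theorem finsupp_injective {A : Type u} [CommRing A] [IsNoetherianRing A] {Z ι : Type u}
    [AddCommGroup Z] [Module A Z] [Module.Injective A Z] : Module.Injective A (ι →₀ Z) := by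
  classical
  refine Module.Baer.injective fun I g => ?_
  obtain ⟨s, hs⟩ := finsupp_support_subset g
  choose h hh using fun i => Module.Injective.extension_property A Z _ _ I.subtype
    Subtype.val_injective (Finsupp.lapply i ∘ₗ g)
  refine ⟨LinearMap.toSpanSingleton A _
    (Finsupp.onFinset s (fun i => if i ∈ s then h i 1 else 0) (by simp +contextual)), ?_⟩
  intro x hx
  ext i
  have := LinearMap.congr_fun (hh i) ⟨x, hx⟩
  by_cases hi : i ∈ s
  · simp [hi, ← map_smul]; simpa using this
  · simp [hi, hs ⟨x, hx⟩ i hi]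

section
variable {A : Type u} [CommRing A] {Z : Type u} [AddCommGroup Z] [Module A Z]

theorem nonempty_finsupp_equiv_hom
    (hZ : Function.Bijective (fun a : A => (a • LinearMap.id : Z →ₗ[A] Z)))
    [Module.Finite A Z] (ι : Type u) :
    Nonempty ((ι →₀ A) ≃ₗ[A] (Z →ₗ[A] ι →₀ Z)) := by
  classical
  let Φ : (ι →₀ A) →ₗ[A] (Z →ₗ[A] ι →₀ Z) := LinearMap.flip
    { toFun := fun z => Finsupp.mapRange.linearMap (LinearMap.toSpanSingleton A Z z)
      map_add' := fun _ _ => by ext; simp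
      map_smul' := fun _ _ => by ext; simp }
  have hΦ : ∀ c z i, Φ c z i = c i • z := fun c z i => by simp [Φ]
  refine ⟨LinearEquiv.ofBijective Φ ⟨fun c c' h => ?_, fun f => ?_⟩⟩
  · ext i
    refine hZ.1 (LinearMap.ext fun z => ?_)
    simpa [hΦ] using DFunLike.congr_fun (LinearMap.congr_fun h z) i
  · obtain ⟨s, hs⟩ := finsupp_support_subset f
    choose c hc using fun i => hZ.2 (Finsupp.lapply i ∘ₗ f)
    refine ⟨Finsupp.onFinset s (fun i => if i ∈ s then c i else 0) (by simp +contextual), ?_⟩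
    ext z i
    rw [hΦ]
    by_cases hi : i ∈ s
    · simpa [hi] using LinearMap.congr_fun (hc i) z
    · simp [hi, hs z i hi]

theorem exists_equiv_finsupp
    (hZ : Function.Bijective (fun a : A => (a • LinearMap.id : Z →ₗ[A] Z)))
    [IsLocalRing A] [IsArtinianRing A] [Module.Injective A Z]
    (K : Type u) [AddCommGroup K] [Module A K] [Module.Injective A K] :
    ∃ ι : Type u, Nonempty (K ≃ₗ[A] (ι →₀ Z)) := by
  classical
  have : Nontrivial Z := by
    by_contra h
    rw [not_nontrivial_iff_subsingleton] at h
    exact zero_ne_one (hZ.1 (Subsingleton.elim _ _) : (0 : A) = 1)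
  obtain ⟨z, hz⟩ := exists_ne (0 : Z)
  obtain ⟨a, hz0, hmz0⟩ := exists_smul_mem_socle (A := A) hz
  generalize a • z = z0 at hz0 hmz0
  have hsoc : ∀ y : Z, (∀ b ∈ maximalIdeal A, b • y = 0) → ∃ a : A, y = a • z0 := by
    intro y hy
    obtain ⟨h, rfl⟩ := exists_linearMap_apply_eq_of_socle hz0 hmz0 hy
    obtain ⟨a, rfl⟩ := hZ.2 h
    exact ⟨a, rfl⟩
  let V := Submodule.torsionBySet A K (maximalIdeal A)
  let _ : Field (A ⧸ maximalIdeal A) := Ideal.Quotient.field _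
  let b := Module.Free.chooseBasis (A ⧸ maximalIdeal A) V
  let ι := Module.Free.ChooseBasisIndex (A ⧸ maximalIdeal A) V
  have hmb : ∀ i, ∀ r ∈ maximalIdeal A, r • (b i : K) = 0 := fun i r hr =>
    (Submodule.mem_torsionBySet_iff _ _).1 (b i).2 ⟨r, hr⟩
  choose f hf using fun i => exists_linearMap_apply_eq_of_socle hz0 hmz0 (hmb i)
  let F : (ι →₀ Z) →ₗ[A] K := Finsupp.lsum A f
  have hFb : ∀ c : ι →₀ A, F (c.mapRange (· • z0) (zero_smul A z0)) =
      ((c.sum fun i r => (Ideal.Quotient.mk (maximalIdeal A) r) • b i : V) : K) := by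
    intro c
    simp only [F, Finsupp.lsum_apply]
    rw [Finsupp.sum_mapRange_index (by simp)]
    simp only [Finsupp.sum, map_smul, hf]
    rw [AddSubmonoidClass.coe_finsetSum]
    rfl
  have hFinj : Function.Injective F := by
    rw [injective_iff_map_eq_zero]
    intro x hx
    by_contra hx0
    obtain ⟨a, hax, hmax⟩ := exists_smul_mem_socle (A := A) hx0
    have hFax : F (a • x) = 0 := by rw [map_smul, hx, smul_zero]
    generalize a • x = y at hax hmax hFax
    have : ∀ i, ∃ c : A, y i = c • z0 := fun i => hsoc (y i) fun b hb => by
      simpa using DFunLike.congr_fun (hmax b hb) i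
    choose c hc using this
    let c' : ι →₀ A := Finsupp.onFinset y.support (fun i => if i ∈ y.support then c i else 0)
      (by simp +contextual)
    have hy : y = c'.mapRange (· • z0) (zero_smul A z0) := by
      ext i
      by_cases hi : y i = 0
      · simp [c', hi]
      · simp [c', hc i]
    rw [hy, hFb, ZeroMemClass.coe_eq_zero] at hFax
    refine hax ?_
    have hli := linearIndependent_iff'.1 b.linearIndependent c'.support
      (fun i => Ideal.Quotient.mk (maximalIdeal A) (c' i)) hFax
    rw [hy]
    ext i
    by_cases hi : i ∈ c'.support
    · simpa using hmz0 _ (Ideal.Quotient.eq_zero_iff_mem.1 (hli i hi))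
    · simp [Finsupp.notMem_support_iff.1 hi]
  have := finsupp_injective (A := A) (Z := Z) (ι := ι)
  obtain ⟨ρ, hρ⟩ := Module.Injective.extension_property A (ι →₀ Z) _ _ F hFinj LinearMap.id
  have hρF : ∀ x, ρ (F x) = x := fun x => LinearMap.congr_fun hρ x
  refine ⟨ι, ⟨LinearEquiv.ofBijective ρ ⟨?_, fun x => ⟨F x, hρF x⟩⟩⟩⟩
  rw [injective_iff_map_eq_zero]
  intro x hx
  by_contra hx0
  obtain ⟨a, hax, hmax⟩ := exists_smul_mem_socle (A := A) hx0
  have hρax : ρ (a • x) = 0 := by rw [map_smul, hx, smul_zero]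
  generalize a • x = y at hax hmax hρax
  have hyV : y ∈ V := (Submodule.mem_torsionBySet_iff _ _).2 fun r => hmax r r.2
  have hrange : ∀ v ∈ Submodule.span (A ⧸ maximalIdeal A) (Set.range b),
      (v : K) ∈ LinearMap.range F := by
    intro v hv
    induction hv using Submodule.span_induction with
    | mem _ h =>
      obtain ⟨i, rfl⟩ := h
      exact ⟨Finsupp.single i z0, by simp [F, hf]⟩
    | zero => exact Submodule.zero_mem _
    | add _ _ _ _ h h' => exact Submodule.add_mem _ h h'
    | smul r _ _ h =>
      obtain ⟨r, rfl⟩ := Ideal.Quotient.mk_surjective r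
      exact Submodule.smul_mem _ r h
  obtain ⟨w, rfl⟩ := hrange ⟨y, hyV⟩ (b.mem_span _)
  rw [hρF] at hρax
  exact hax (by rw [hρax, map_zero])
end
end ArtinianLocal

section Localization
variable {R : Type u} [CommRing R] (S : Submonoid R)

theorem isUnit_algebraMap_end_of_localization (Y : Type u) [AddCommGroup Y] [Module R Y]
    [Module (Localization S) Y] [IsScalarTower R (Localization S) Y] (s : S) :
    IsUnit (algebraMap R (Module.End R Y) s) := by
  have h := (IsLocalization.map_units (Localization S) s).map
    (algebraMap (Localization S) (Module.End (Localization S) Y))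
  rw [Module.End.isUnit_iff] at h ⊢
  convert h using 1
  ext y
  simp

theorem exists_linearMap_localizedModule {M Y : Type u} [AddCommGroup M] [Module R M]
    [AddCommGroup Y] [Module R Y]
    [Module (Localization S) Y] [IsScalarTower R (Localization S) Y] {M' : Type u}
    [AddCommGroup M'] [Module R M'] [Module (Localization S) M']
    [IsScalarTower R (Localization S) M'] (φ : M →ₗ[R] M') [IsLocalizedModule S φ]
    (f : M →ₗ[R] Y) :
    ∃ g : M' →ₗ[Localization S] Y, ∀ m, g (φ m) = f m :=
  ⟨(IsLocalizedModule.lift S φ f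
    (isUnit_algebraMap_end_of_localization S Y)).extendScalarsOfIsLocalization S _,
    fun m => IsLocalizedModule.lift_apply S φ f (isUnit_algebraMap_end_of_localization S Y) m⟩

theorem injective_of_localization {Y : Type u} [AddCommGroup Y] [Module R Y]
    [Module (Localization S) Y] [IsScalarTower R (Localization S) Y]
    [Module.Injective (Localization S) Y] : Module.Injective R Y := by
  refine ⟨fun M N _ _ _ _ f hf g => ?_⟩
  obtain ⟨g', hg'⟩ := exists_linearMap_localizedModule S (LocalizedModule.mkLinearMap S M) g
  obtain ⟨h, hh⟩ := Module.Injective.extension_property (Localization S) Y _ _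
    (LocalizedModule.map S f) (LocalizedModule.map_injective S f hf) g'
  refine ⟨h.restrictScalars R ∘ₗ LocalizedModule.mkLinearMap S N, fun x => ?_⟩
  have := LinearMap.congr_fun hh (LocalizedModule.mkLinearMap S M x)
  rw [hg'] at this
  simpa using this

theorem injective_localizedModule_of_injDimLE [IsNoetherianRing R] [IsLocalRing (Localization S)]
    [IsArtinianRing (Localization S)] (n : ℕ) : ∀ M : ModuleCat.{u} R, InjDimLE R n M →
      Module.Injective (Localization S) (LocalizedModule S M) := by
  induction n with
  | zero =>
    intro M hM
    have : Module.Injective R M := hM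
    exact Module.injective_of_isLocalizedModule S (LocalizedModule.mkLinearMap S M)
  | succ n ih =>
    rintro M ⟨I, hI, ι, hι, hN⟩
    have := Module.injective_of_isLocalizedModule (Rₛ := Localization S) S
      (LocalizedModule.mkLinearMap S I)
    have := ih _ hN
    have hex := LinearMap.exact_map_mkQ_range ι
    exact ArtinianLocal.injective_of_exact (LocalizedModule.map S ι)
      (LocalizedModule.map S (LinearMap.range ι).mkQ)
      (LocalizedModule.map_injective S ι hι)
      (LocalizedModule.map_surjective S _ (Submodule.mkQ_surjective _))
      (LocalizedModule.map_exact S ι _ hex)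

variable {C : Type u} [AddCommGroup C] [Module R C]

theorem bijective_homothety_localizedModule [IsNoetherianRing R] [Module.Finite R C]
    (hC : Function.Bijective (fun r : R => (r • LinearMap.id : C →ₗ[R] C))) :
    Function.Bijective (fun a : Localization S =>
      (a • LinearMap.id : LocalizedModule S C →ₗ[Localization S] LocalizedModule S C)) := by
  have := Module.finitePresentation_of_finite R C
  let h : R ≃ₗ[R] (C →ₗ[R] C) :=
    LinearEquiv.ofBijective (LinearMap.toSpanSingleton R _ (LinearMap.id : C →ₗ[R] C)) hC
  let mk := LocalizedModule.mkLinearMap S C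
  let φ := IsLocalizedModule.mapExtendScalars S mk mk (Localization S) ∘ₗ h.toLinearMap
  let e := IsLocalizedModule.linearEquiv S (Algebra.linearMap R (Localization S)) φ
  let η : Localization S →ₗ[R] (LocalizedModule S C →ₗ[Localization S] LocalizedModule S C) :=
    (LinearMap.toSpanSingleton (Localization S) _
      (LinearMap.id : LocalizedModule S C →ₗ[Localization S] LocalizedModule S C)).restrictScalars R
  have : e.toLinearMap = η := by
    refine IsLocalizedModule.linearMap_ext S (Algebra.linearMap R (Localization S)) φ ?_
    ext : 1
    simp only [LinearMap.comp_apply, LinearEquiv.coe_coe, e]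
    rw [IsLocalizedModule.linearEquiv_apply]
    refine LinearMap.restrictScalars_injective R (IsLocalizedModule.linearMap_ext S mk mk ?_)
    have h_one : h 1 = LinearMap.id := one_smul R _
    have h_map : IsLocalizedModule.map S mk mk (h 1) ∘ₗ mk = mk := by
      rw [h_one]
      exact IsLocalizedModule.map_comp S mk mk _
    ext c
    simpa [φ, η] using LinearMap.congr_fun h_map c
  have he : (fun a : Localization S =>
      (a • LinearMap.id : LocalizedModule S C →ₗ[Localization S] LocalizedModule S C)) = e := by
    funext a
    exact (LinearMap.congr_fun this a).symm
  rw [he]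
  exact e.bijective

theorem nonempty_finsupp_equiv_hom_localizedModule [Module.Finite R C]
    (hZ : Function.Bijective (fun a : Localization S =>
      (a • LinearMap.id : LocalizedModule S C →ₗ[Localization S] LocalizedModule S C)))
    (ι : Type u) :
    Nonempty ((ι →₀ Localization S) ≃ₗ[R] (C →ₗ[R] ι →₀ LocalizedModule S C)) := by
  have : Module.Finite (Localization S) (LocalizedModule S C) :=
    Module.Finite.of_isLocalizedModule S (LocalizedModule.mkLinearMap S C)
  obtain ⟨e⟩ := ArtinianLocal.nonempty_finsupp_equiv_hom hZ ι
  let r : (LocalizedModule S C →ₗ[Localization S] ι →₀ LocalizedModule S C) →ₗ[R]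
      (C →ₗ[R] ι →₀ LocalizedModule S C) :=
    { toFun := fun f => f.restrictScalars R ∘ₗ LocalizedModule.mkLinearMap S C
      map_add' := fun _ _ => rfl
      map_smul' := fun _ _ => rfl }
  refine ⟨(e.restrictScalars R).trans (LinearEquiv.ofBijective r ⟨fun f g hfg => ?_, fun f => ?_⟩)⟩
  · exact LinearMap.restrictScalars_injective R (IsLocalizedModule.ext S
      (LocalizedModule.mkLinearMap S C) (isUnit_algebraMap_end_of_localization S _) hfg)
  · obtain ⟨g, hg⟩ := exists_linearMap_localizedModule S (LocalizedModule.mkLinearMap S C) f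
    exact ⟨g, LinearMap.ext hg⟩

theorem exists_lift_of_hom_injective [IsNoetherianRing R] [IsLocalRing (Localization S)]
    [IsArtinianRing (Localization S)] [Module.Finite R C]
    [Module.Injective (Localization S) (LocalizedModule S C)]
    (hZ : Function.Bijective (fun a : Localization S =>
      (a • LinearMap.id : LocalizedModule S C →ₗ[Localization S] LocalizedModule S C)))
    {J : Type u} [AddCommGroup J] [Module R J] [Module.Injective R J]
    {Y W : Type u} [AddCommGroup Y] [Module R Y] [Module (Localization S) Y]
    [IsScalarTower R (Localization S) Y] [AddCommGroup W] [Module R W] [Module (Localization S) W]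
    [IsScalarTower R (Localization S) W] (π : Y →ₗ[Localization S] W)
    (hπ : Function.Surjective π) (g : (C →ₗ[R] J) →ₗ[R] W) :
    ∃ h : (C →ₗ[R] J) →ₗ[R] Y, ∀ x, π (h x) = g x := by
  have := Module.finitePresentation_of_finite R C
  have : Module.Finite (Localization S) (LocalizedModule S C) :=
    Module.Finite.of_isLocalizedModule S (LocalizedModule.mkLinearMap S C)
  have := Module.injective_of_isLocalizedModule (Rₛ := Localization S) S
    (LocalizedModule.mkLinearMap S J)
  obtain ⟨ι, ⟨e⟩⟩ := ArtinianLocal.exists_equiv_finsupp hZ (LocalizedModule S J)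
  obtain ⟨e'⟩ := ArtinianLocal.nonempty_finsupp_equiv_hom hZ ι
  have : Module.Projective (Localization S)
      (LocalizedModule S C →ₗ[Localization S] LocalizedModule S J) :=
    Module.Projective.of_equiv (e'.trans (LinearEquiv.congrRight e.symm))
  let φ := IsLocalizedModule.mapExtendScalars S (LocalizedModule.mkLinearMap S C)
    (LocalizedModule.mkLinearMap S J) (Localization S)
  obtain ⟨g', hg'⟩ := exists_linearMap_localizedModule S φ g
  obtain ⟨h, hh⟩ := Module.projective_lifting_property π g' hπ
  refine ⟨h.restrictScalars R ∘ₗ φ, fun x => ?_⟩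
  rw [← hg' x, ← hh]
  rfl

theorem cGorensteinInjective_of_shortExact [IsNoetherianRing R] [IsLocalRing (Localization S)]
    [IsArtinianRing (Localization S)] [Module.Finite R C]
    [Module.Injective (Localization S) (LocalizedModule S C)]
    (hZ : Function.Bijective (fun a : Localization S =>
      (a • LinearMap.id : LocalizedModule S C →ₗ[Localization S] LocalizedModule S C)))
    (W : ℤ → ModuleCat.{u} (Localization S))
    (hW : ∀ i, ∃ (X : ModuleCat.{u} (Localization S)) (ι : W i →ₗ[Localization S] X)
      (π : X →ₗ[Localization S] W (i + 1)), Function.Injective ι ∧ Function.Surjective π ∧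
        Function.Exact ι π ∧ (0 ≤ i → Module.Injective (Localization S) X) ∧
        (i < 0 → ∃ κ : Type u, Nonempty (X ≃ₗ[Localization S] (κ →₀ Localization S))))
    (T : Type u) [AddCommGroup T] [Module R T] [Module (Localization S) T]
    [IsScalarTower R (Localization S) T] (e : T ≃ₗ[Localization S] W 0) :
    CGorensteinInjective R C T := by
  choose X ι π hι hπ hex hinj hfree using hW
  let _ (Y : ModuleCat.{u} (Localization S)) : Module R Y :=
    Module.compHom Y (algebraMap R (Localization S))
  have (Y : ModuleCat.{u} (Localization S)) : IsScalarTower R (Localization S) Y :=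
    ⟨fun r a y => by rw [Algebra.smul_def, mul_smul]; rfl⟩
  let d (i : ℤ) : X i →ₗ[R] X (i + 1) :=
    (ι (i + 1)).restrictScalars R ∘ₗ (π i).restrictScalars R
  have hd (i : ℤ) (x : X i) : d i x = ι (i + 1) (π i x) := rfl
  have hd0 (i : ℤ) (x : X i) : d i x = 0 ↔ π i x = 0 := by
    rw [hd, map_eq_zero_iff _ (hι _)]
  let res : CompleteICIRes R C :=
    { X := fun i => X i
      d := d
      exct := fun i => by
        ext x
        rw [LinearMap.mem_ker, hd0, hex (i + 1) x]
        constructor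
        · rintro ⟨y, rfl⟩
          exact ⟨π i y, rfl⟩
        · rintro ⟨w, rfl⟩
          obtain ⟨y, rfl⟩ := hπ i w
          exact ⟨y, rfl⟩
      injPos := fun i hi => by
        have := hinj i hi
        exact injective_of_localization S
      homCInjNeg := fun i hi => by
        obtain ⟨κ, ⟨f⟩⟩ := hfree i hi
        obtain ⟨g⟩ := nonempty_finsupp_equiv_hom_localizedModule S hZ κ
        have := ArtinianLocal.finsupp_injective (A := Localization S)
          (Z := LocalizedModule S C) (ι := κ)
        exact ⟨κ →₀ LocalizedModule S C, inferInstance, inferInstance,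
          injective_of_localization S, ⟨(f.restrictScalars R).trans g⟩⟩
      homExact := by
        intro J _ _ hJ i g hg
        let ιR := LinearEquiv.ofInjective ((ι (i + 1)).restrictScalars R) (hι (i + 1))
        have hmem (x : C →ₗ[R] J) : g x ∈ LinearMap.range ((ι (i + 1)).restrictScalars R) :=
          (hex (i + 1) (g x)).1 ((hd0 _ _).1 (LinearMap.congr_fun hg x))
        obtain ⟨h, hh⟩ := exists_lift_of_hom_injective S hZ (π i) (hπ i)
          (ιR.symm.toLinearMap ∘ₗ g.codRestrict _ hmem)
        refine ⟨h, LinearMap.ext fun x => ?_⟩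
        rw [LinearMap.comp_apply, hd, hh]
        exact congrArg Subtype.val (ιR.apply_symm_apply ⟨g x, hmem x⟩) }
  let e' : T ≃ₗ[Localization S] W (-1 + 1) := e
  let f : T →ₗ[R] X (-1 + 1) := (ι (-1 + 1)).restrictScalars R ∘ₗ
    (e'.restrictScalars R).toLinearMap
  refine ⟨res, ⟨(LinearEquiv.ofInjective f ((hι _).comp e'.injective)).trans
    (LinearEquiv.ofEq _ _ ?_)⟩⟩
  ext x
  constructor
  · rintro ⟨t, rfl⟩
    obtain ⟨y, hy⟩ := hπ (-1) (e' t)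
    exact ⟨y, congrArg (ι (-1 + 1)) hy⟩
  · rintro ⟨y, rfl⟩
    exact ⟨e'.symm (π (-1) y), congrArg (ι (-1 + 1)) (e'.apply_symm_apply _)⟩

end Localization

theorem exists_int_sequence {α : Type*} {r q : α → α → Prop} (hr : ∀ a, ∃ b, r a b)
    (hq : ∀ b, ∃ a, q a b) (a : α) : ∃ W : ℤ → α, W 0 = a ∧
      (∀ i, 0 ≤ i → r (W i) (W (i + 1))) ∧ ∀ i < 0, q (W i) (W (i + 1)) := by
  choose f hf using hr
  choose g hg using hq
  refine ⟨fun | .ofNat n => f^[n] a | .negSucc n => g^[n + 1] a, rfl, ?_, ?_⟩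
  · rintro (n | n) hi
    · change r (f^[n] a) (f^[n + 1] a)
      rw [Function.iterate_succ_apply']
      exact hf _
    · exact absurd hi (by simp)
  · rintro (n | n) hi
    · exact absurd hi (by simp)
    · cases n with
      | zero => exact hg a
      | succ n =>
        change q (g^[n + 2] a) (g^[n + 1] a)
        rw [Function.iterate_succ_apply' g (n + 1)]
        exact hg _

theorem cGorensteinInjective_of_localizedModule {R : Type u} [CommRing R] (S : Submonoid R)
    {C : Type u} [AddCommGroup C] [Module R C] [IsNoetherianRing R]
    [IsLocalRing (Localization S)]
    [IsArtinianRing (Localization S)] [Module.Finite R C]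
    [Module.Injective (Localization S) (LocalizedModule S C)]
    (hZ : Function.Bijective (fun a : Localization S =>
      (a • LinearMap.id : LocalizedModule S C →ₗ[Localization S] LocalizedModule S C)))
    (T : Type u) [AddCommGroup T] [Module R T] [Module (Localization S) T]
    [IsScalarTower R (Localization S) T] : CGorensteinInjective R C T := by
  let A := Localization S
  obtain ⟨W, hW0, hpos, hneg⟩ := exists_int_sequence (α := ModuleCat.{u} A)
    (r := fun L L' => ∃ (X : ModuleCat.{u} A) (ι : L →ₗ[A] X) (π : X →ₗ[A] L'),
      Function.Injective ι ∧ Function.Surjective π ∧ Function.Exact ι π ∧ Module.Injective A X)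
    (q := fun L L' => ∃ (X : ModuleCat.{u} A) (ι : L →ₗ[A] X) (π : X →ₗ[A] L'),
      Function.Injective ι ∧ Function.Surjective π ∧ Function.Exact ι π ∧
        ∃ κ : Type u, Nonempty (X ≃ₗ[A] (κ →₀ A)))
    (fun L => by
      obtain ⟨⟨X, hX, ι, hι⟩⟩ := EnoughInjectives.presentation L
      refine ⟨ModuleCat.of A (X ⧸ LinearMap.range ι.hom), X, ι.hom, Submodule.mkQ _,
        (ModuleCat.mono_iff_injective ι).1 hι, Submodule.mkQ_surjective _,
        LinearMap.exact_map_mkQ_range _, ?_⟩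
      exact (Module.injective_iff_injective_object A X).2 hX)
    (fun L => by
      let π := Finsupp.linearCombination A (id : L → L)
      exact ⟨ModuleCat.of A (LinearMap.ker π), ModuleCat.of A (L →₀ A),
        (LinearMap.ker π).subtype, π, Subtype.val_injective,
        Finsupp.linearCombination_id_surjective A L, LinearMap.exact_subtype_ker_map π,
        L, ⟨LinearEquiv.refl _ _⟩⟩)
    (ModuleCat.of A T)
  refine cGorensteinInjective_of_shortExact S hZ W (fun i => ?_) T
    (hW0 ▸ LinearEquiv.refl A T)
  rcases le_or_gt 0 i with hi | hi
  · obtain ⟨X, ι, π, hι, hπ, hex, hX⟩ := hpos i hi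
    exact ⟨X, ι, π, hι, hπ, hex, fun _ => hX, fun h => absurd hi h.not_ge⟩
  · obtain ⟨X, ι, π, hι, hπ, hex, hX⟩ := hneg i hi
    exact ⟨X, ι, π, hι, hπ, hex, fun h => absurd hi h.not_gt, fun _ => hX⟩

/-- Over a Cohen-Macaulay noetherian ring `R` with dualizing module `D` and
semidualizing module `C`, if `p` is a minimal prime of `R` with `C_p ≅ D_p`, then every
`R_p`-module `T` is `C`-Gorenstein injective as an `R`-module. -/
theorem statement18 (R : Type u) [CommRing R] [IsNoetherianRing R]
    (hCM : IsCohenMacaulayRing R)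
    (D : Type u) [AddCommGroup D] [Module R D] (hD : IsDualizing R D)
    (C : Type u) [AddCommGroup C] [Module R C] (hC : IsSemidualizing R C)
    (p : Ideal R) (hp : p.IsPrime) (hmin : p ∈ minimalPrimes R)
    (hCD : Nonempty ((LocalizedModule p.primeCompl C) ≃ₗ[Localization.AtPrime p]
      (LocalizedModule p.primeCompl D)))
    (T : Type u) [AddCommGroup T] [Module R T]
    [Module (Localization.AtPrime p) T] [IsScalarTower R (Localization.AtPrime p) T] :
    CGorensteinInjective R C T := by
  have := hC.1
  have : Subsingleton (PrimeSpectrum (Localization.AtPrime p)) :=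
    IsLocalization.subsingleton_primeSpectrum_of_mem_minimalPrimes p hmin _
  have : Ring.KrullDimLE 0 (Localization.AtPrime p) :=
    inferInstanceAs (Order.KrullDimLE 0 (PrimeSpectrum (Localization.AtPrime p)))
  have : IsNoetherianRing (Localization.AtPrime p) :=
    IsLocalization.isNoetherianRing p.primeCompl _ inferInstance
  have : IsArtinianRing (Localization.AtPrime p) :=
    IsNoetherianRing.isArtinianRing_of_krullDimLE_zero
  obtain ⟨n, hn⟩ := hD.2
  obtain ⟨e⟩ := hCD
  have hDp := injective_localizedModule_of_injDimLE p.primeCompl n _ hn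
  have : Module.Injective (Localization.AtPrime p) (LocalizedModule p.primeCompl C) :=
    (Module.Baer.of_equiv e.symm (Module.Baer.of_injective hDp)).injective
  exact cGorensteinInjective_of_localizedModule p.primeCompl
    (bijective_homothety_localizedModule p.primeCompl hC.2.1) T
end
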